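/- arXiv:0707.2873 — 4 statements merged into one kernel-verified Lean document; each statement's English description precedes it below -/
import Mathlib

section
/- Let q = p^a with p an odd prime, let V = F_q^e with basis u_1, …, u_e, let A ≤ GL(e, q) be the group of all scalar matrices, let D ≤ GL(e, q) be a finite group of diagonal matrices with A ≤ D and D = A × D_0 where D_0 = C_D(u_1), and let S be a group of permutation matrices permuting the basis {u_1, …, u_e} regularly, with F = DS a subgroup in which D is normal and in which every permutation matrix of F lies in S. Assume the lines ⟨u_i⟩, 1 ≤ i ≤ e, are pairwise non-equivalent irreducible F_q-representations of D_0, and that every non-identity element of D has at most e/2 diagonal entries equal to 1. Let G ≤ GL(e, q) be a finite group with F normal in G and gcd(|G|, p) = 1. Then for every g ∈ G with g(u_1) = u_1: (1) D_0^g = D_0 and g is a monomial matrix, so g = δ(g)π(g) for a unique diagonal matrix δ(g) and permutation matrix π(g); (2) π(g) normalizes S; (3) both δ(g) and π(g) normalize F, and [δ(g), S] ≤ D; (4) if δ(g) ≠ 1, then the number of diagonal entries of δ(g) equal to 1 is at most (3/4)e. -/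
open Matrix

namespace MonomialStabilizer

/-- If every nontrivial `c⁻¹ (c ∘ τ)` has few entries equal to `1`, for `τ` in a set of
permutations moving `i₀` everywhere, then so does `c`. -/
lemma four_mul_ncard_le {n M : Type*} [Fintype n] [One M] {c : n → M}
    {T : Set (Equiv.Perm n)} {i₀ : n} (hc : c i₀ = 1)
    (htrans : ∀ i, ∃ τ ∈ T, τ i₀ = i)
    (hhalf : ∀ τ ∈ T, (∃ i, c (τ i) ≠ c i) → 2 * {i | c (τ i) = c i}.ncard ≤ Fintype.card n)
    (hne : c ≠ 1) : 4 * {i | c i = 1}.ncard ≤ 3 * Fintype.card n := by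
  obtain ⟨i, hi⟩ := Function.ne_iff.1 hne
  obtain ⟨τ, hτ, rfl⟩ := htrans i
  have h := hhalf τ hτ ⟨i₀, by rw [hc]; exact hi⟩
  set X := {i | c i = 1}
  have himg : (τ ⁻¹' X).ncard = X.ncard :=
    Set.ncard_preimage_of_injective_subset_range τ.injective (by simp)
  have hsub : X ∩ τ ⁻¹' X ⊆ {i | c (τ i) = c i} := fun j hj => hj.2.trans hj.1.symm
  have hle := Set.ncard_le_ncard hsub (Set.toFinite _)
  have hadd := Set.ncard_union_add_ncard_inter X (τ ⁻¹' X)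
  have huniv : (X ∪ τ ⁻¹' X).ncard ≤ Fintype.card n := by
    rw [← Nat.card_eq_fintype_card, ← Set.ncard_univ]
    exact Set.ncard_le_ncard (Set.subset_univ _)
  omega

variable {n K : Type*} [Fintype n] [DecidableEq n] [Field K]

/-- The invertible diagonal matrix with given diagonal entries. -/
def diagHom : (n → Kˣ) →* GL n K :=
  (Units.map (Matrix.diagonalRingHom n K).toMonoidHom).comp
    (MulEquiv.piUnits (M := fun _ : n => K)).symm.toMonoidHom

/-- The permutation matrix sending the `j`-th basis vector to the `σ j`-th one. -/
def permHom : Equiv.Perm n →* GL n K :=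
  MonoidHom.toHomUnits
    { toFun := fun σ => (σ⁻¹).permMatrix K
      map_one' := by simp
      map_mul' := fun σ τ => by rw [_root_.mul_inv_rev, Matrix.permMatrix_mul] }

lemma coe_diagHom (c : n → Kˣ) :
    (diagHom c : Matrix n n K) = Matrix.diagonal fun i => (c i : K) := rfl

lemma coe_permHom (σ : Equiv.Perm n) :
    (permHom (K := K) σ : Matrix n n K) = (σ⁻¹).permMatrix K := rfl

lemma diagHom_mulVec_single (c : n → Kˣ) (j : n) (x : K) :
    (diagHom c : Matrix n n K) *ᵥ Pi.single j x = Pi.single j (c j * x) := by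
  rw [coe_diagHom, Matrix.diagonal_mulVec_single]

lemma permHom_mulVec_single (σ : Equiv.Perm n) (j : n) (x : K) :
    (permHom (K := K) σ : Matrix n n K) *ᵥ Pi.single j x = Pi.single (σ j) x := by
  rw [coe_permHom, Matrix.permMatrix_mulVec]
  ext i
  by_cases h : i = σ j
  · subst h; simp
  · have : σ⁻¹ i ≠ j := fun h' => h (by simp [← h'])
    rw [Function.comp_apply, Pi.single_eq_of_ne this, Pi.single_eq_of_ne h]

lemma ext_single {g h : GL n K}
    (H : ∀ j, (g : Matrix n n K) *ᵥ Pi.single j 1 = (h : Matrix n n K) *ᵥ Pi.single j 1) :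
    g = h :=
  Units.ext (Matrix.ext_of_mulVec_single H)

lemma monomial_mulVec_single (c : n → Kˣ) (σ : Equiv.Perm n) (j : n) (x : K) :
    ((diagHom c * permHom σ : GL n K) : Matrix n n K) *ᵥ Pi.single j x =
      Pi.single (σ j) (c (σ j) * x) := by
  rw [Units.val_mul, ← Matrix.mulVec_mulVec, permHom_mulVec_single, diagHom_mulVec_single]

lemma permHom_mul_diagHom (c : n → Kˣ) (σ : Equiv.Perm n) :
    (permHom σ * diagHom c : GL n K) = diagHom (c ∘ ⇑σ⁻¹) * permHom σ := by
  refine ext_single fun j => ?_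
  rw [monomial_mulVec_single, Units.val_mul, ← Matrix.mulVec_mulVec, diagHom_mulVec_single,
    permHom_mulVec_single]
  simp

lemma monomial_inj {c c' : n → Kˣ} {σ σ' : Equiv.Perm n}
    (h : (diagHom c * permHom σ : GL n K) = diagHom c' * permHom σ') : c = c' ∧ σ = σ' := by
  have key : ∀ j, σ j = σ' j ∧ c (σ j) = c' (σ' j) := by
    intro j
    have hj : (Pi.single (σ j) ((c (σ j) : K) * 1) : n → K) =
        Pi.single (σ' j) ((c' (σ' j) : K) * 1) := by
      rw [← monomial_mulVec_single, ← monomial_mulVec_single, h]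
    have hσ : σ j = σ' j := by
      by_contra hne
      have := congrFun hj (σ j)
      simp [hne] at this
    refine ⟨hσ, ?_⟩
    have := congrFun hj (σ j)
    rw [hσ] at this ⊢
    simpa [Units.ext_iff] using this
  have hσ : σ = σ' := Equiv.ext fun j => (key j).1
  subst hσ
  refine ⟨funext fun i => ?_, rfl⟩
  simpa using (key (σ.symm i)).2

lemma isDiag_iff {g : GL n K} :
    (g : Matrix n n K).IsDiag ↔ g ∈ (diagHom (n := n) (K := K)).range := by
  constructor
  · intro h
    have hd := h.diagonal_diag
    have hdet : IsUnit (g : Matrix n n K).det := (Matrix.isUnit_iff_isUnit_det _).1 g.isUnit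
    rw [← hd, Matrix.det_diagonal] at hdet
    have hne : ∀ i, (g : Matrix n n K) i i ≠ 0 := fun i =>
      Finset.prod_ne_zero_iff.1 hdet.ne_zero i (Finset.mem_univ i)
    exact ⟨fun i => Units.mk0 _ (hne i), Units.ext (by rw [coe_diagHom]; exact hd)⟩
  · rintro ⟨c, rfl⟩
    exact Matrix.isDiag_diagonal _

lemma perm_iff {g : GL n K} : (∃ σ : Equiv.Perm n,
    ∀ j, (g : Matrix n n K) *ᵥ Pi.single j 1 = Pi.single (σ j) 1) ↔
      g ∈ (permHom (n := n) (K := K)).range := by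
  constructor
  · rintro ⟨σ, h⟩
    exact ⟨σ, ext_single fun j => by rw [h, permHom_mulVec_single]⟩
  · rintro ⟨σ, rfl⟩
    exact ⟨σ, fun j => permHom_mulVec_single σ j 1⟩

/-- A matrix normalizing a diagonal group that separates the coordinates is monomial. -/
lemma exists_monomial {D₀ : Subgroup (GL n K)} (hdiag : D₀ ≤ (diagHom (n := n) (K := K)).range)
    (hsep : ∀ i j : n, i ≠ j → ∃ d ∈ D₀, (d : Matrix n n K) i i ≠ (d : Matrix n n K) j j)
    {g : GL n K} (hg : ∀ d ∈ D₀, g⁻¹ * d * g ∈ D₀) :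
    ∃ (c : n → Kˣ) (σ : Equiv.Perm n), g = diagHom c * permHom σ := by
  have uniq : ∀ i k j, (g : Matrix n n K) i j ≠ 0 → (g : Matrix n n K) k j ≠ 0 → i = k := by
    intro i k j hi hk
    by_contra hik
    obtain ⟨d, hd, hne⟩ := hsep i k hik
    obtain ⟨c', hc'⟩ := hdiag (hg d hd)
    obtain ⟨c, rfl⟩ := hdiag hd
    have hcomm : (diagHom c * g : GL n K) = g * diagHom c' := by
      rw [hc', mul_assoc, mul_inv_cancel_left]
    have hentry : ∀ l, (c l : K) * (g : Matrix n n K) l j = (g : Matrix n n K) l j * c' j := by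
      intro l
      have := congrArg (fun x : GL n K => (x : Matrix n n K) l j) hcomm
      simpa [coe_diagHom, Matrix.diagonal_mul, Matrix.mul_diagonal] using this
    have hval : ∀ l, (g : Matrix n n K) l j ≠ 0 → (c l : K) = c' j := fun l hl =>
      mul_right_cancel₀ hl (by rw [hentry l, mul_comm])
    exact hne (by simp [coe_diagHom, hval i hi, hval k hk])
  have ginj : Function.Injective fun v => (g : Matrix n n K) *ᵥ v :=
    Matrix.mulVec_injective_of_isUnit g.isUnit
  have exi : ∀ j, ∃ i, (g : Matrix n n K) i j ≠ 0 := by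
    intro j
    by_contra! h
    have : (Pi.single j 1 : n → K) = 0 := ginj (by
      ext i
      simp [h])
    simpa using congrFun this j
  choose f hf using exi
  have hcol : ∀ j, (g : Matrix n n K) *ᵥ Pi.single j 1 =
      Pi.single (f j) ((g : Matrix n n K) (f j) j) := by
    intro j
    ext i
    by_cases hi : i = f j
    · subst hi; simp
    · have : (g : Matrix n n K) i j = 0 := by
        by_contra h
        exact hi (uniq _ _ _ h (hf j))
      simp [hi, this]
  have finj : Function.Injective f := by
    intro j k hjk
    by_contra hne
    have : (Pi.single j ((g : Matrix n n K) (f k) k) : n → K) =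
        Pi.single k ((g : Matrix n n K) (f j) j) := ginj (by
      have scale : ∀ (l : n) (x : K), (g : Matrix n n K) *ᵥ Pi.single l x =
          x • Pi.single (f l) ((g : Matrix n n K) (f l) l) := by
        intro l x
        rw [← hcol, ← Matrix.mulVec_smul, ← Pi.single_smul]
        simp
      simp only [scale, hjk, ← Pi.single_smul, smul_eq_mul, mul_comm])
    have := congrFun this j
    simp [hne] at this
    exact hf k this
  let σ : Equiv.Perm n := Equiv.ofBijective f (Finite.injective_iff_bijective.1 finj)
  have hσ : ∀ j, σ j = f j := fun j => rfl
  refine ⟨fun i => Units.mk0 ((g : Matrix n n K) i (σ.symm i)) ?_, σ, ext_single fun j => ?_⟩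
  · have := hf (σ.symm i)
    rwa [← hσ, Equiv.apply_symm_apply] at this
  · rw [monomial_mulVec_single, hcol]
    simp [hσ, σ]

lemma inv_mulVec_eq_self {g : GL n K} {v : n → K} (h : (g : Matrix n n K) *ᵥ v = v) :
    ((g⁻¹ : GL n K) : Matrix n n K) *ᵥ v = v := by
  conv_lhs => rw [← h]
  rw [Matrix.mulVec_mulVec, ← Units.val_mul, inv_mul_cancel, Units.val_one, Matrix.one_mulVec]

lemma diagHom_commute {x y : GL n K} (hx : x ∈ (diagHom (n := n) (K := K)).range)
    (hy : y ∈ (diagHom (n := n) (K := K)).range) : Commute x y := by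
  obtain ⟨c, rfl⟩ := hx
  obtain ⟨d, rfl⟩ := hy
  rw [Commute, SemiconjBy, ← map_mul, ← map_mul, mul_comm]

/-- A monomial matrix normalizing `DS` has permutation part normalizing `S`, and its diagonal part
commutes with `S` modulo `D`. -/
lemma conj_mem_of_monomial {D S F : Subgroup (GL n K)}
    (hD : D ≤ (diagHom (n := n) (K := K)).range) (hS : S ≤ (permHom (n := n) (K := K)).range)
    (hSF : S ≤ F) (hdec : ∀ f ∈ F, ∃ d ∈ D, ∃ s ∈ S, d * s = f)
    {c : n → Kˣ} {σ : Equiv.Perm n}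
    (hg : ∀ f ∈ F, (diagHom c * permHom σ) * f * (diagHom c * permHom σ)⁻¹ ∈ F)
    {s : GL n K} (hs : s ∈ S) :
    permHom σ * s * (permHom σ)⁻¹ ∈ S ∧
      diagHom c * (permHom σ * s * (permHom σ)⁻¹) * (diagHom c)⁻¹ *
        (permHom σ * s * (permHom σ)⁻¹)⁻¹ ∈ D := by
  obtain ⟨d, hd, s', hs', hds⟩ := hdec _ (hg s (hSF hs))
  obtain ⟨b, rfl⟩ := hD hd
  obtain ⟨τ, rfl⟩ := hS hs
  obtain ⟨τ', rfl⟩ := hS hs'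
  have hconj : (diagHom c * permHom σ) * permHom τ * (diagHom c * permHom σ)⁻¹ =
      (diagHom (c * (c⁻¹ ∘ ⇑(σ * τ * σ⁻¹)⁻¹)) * permHom (σ * τ * σ⁻¹) : GL n K) := by
    rw [map_mul diagHom, mul_assoc (diagHom c) (diagHom _), ← permHom_mul_diagHom, map_mul,
      map_mul, map_inv, map_inv]
    simp only [_root_.mul_inv_rev, mul_assoc]
  obtain ⟨hb, hτ⟩ := monomial_inj (hds.trans hconj)
  rw [← map_inv, ← map_mul, ← map_mul, ← hτ]
  refine ⟨hs', ?_⟩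
  rw [hτ] at hds ⊢
  convert hd using 1
  rw [mul_inv_eq_iff_eq_mul, hds, map_mul, map_mul, map_inv]
  simp only [_root_.mul_inv_rev, mul_assoc]

lemma diagHom_mul_conj_permHom (c : n → Kˣ) (τ : Equiv.Perm n) :
    ((diagHom c)⁻¹ * (permHom τ)⁻¹ * diagHom c * permHom τ : GL n K) =
      diagHom fun i => (c i)⁻¹ * c (τ i) := by
  rw [mul_assoc (_ * _), mul_assoc, inv_mul_eq_iff_eq_mul, inv_mul_eq_iff_eq_mul, ← map_mul,
    permHom_mul_diagHom]
  congr 2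
  ext i
  simp

end MonomialStabilizer

open MonomialStabilizer

/-- **Halasi–Podoski, Lemma 3.6 (monomial case).**
Let `q = p^a` (`p` an odd prime), `V = 𝔽_q^e` with basis `u₁,…,u_e`, `A` the scalar matrices,
`D` a finite group of diagonal matrices with `A ≤ D` and `D = A × D₀` where `D₀ = C_D(u₁)`,
and `S` a group of permutation matrices permuting the basis regularly, with `F = DS` in which
`D` is normal and every permutation matrix of `F` lies in `S`.  Assume the lines `⟨uᵢ⟩` are
pairwise non-equivalent irreducible `𝔽_q`-representations of `D₀` and every non-identity
element of `D` has at most `e/2` diagonal entries equal to `1`.  If `F ⊴ G ≤ GL(e, q)` with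
`gcd(|G|, p) = 1`, then every `g ∈ G` with `g(u₁) = u₁` satisfies:
(1) `D₀^g = D₀` and `g` is monomial, `g = δ(g)π(g)` uniquely with `δ(g)` diagonal and `π(g)` a
permutation matrix; (2) `π(g)` normalizes `S`; (3) `δ(g)` and `π(g)` normalize `F` and
`[δ(g), S] ≤ D`; (4) if `δ(g) ≠ 1` then at most `(3/4)e` diagonal entries of `δ(g)` are `1`. -/
theorem monomial_stabilizer_lemma
    (p a : ℕ) (hp : p.Prime) (hp2 : p ≠ 2)
    (K : Type*) [Field K] [Fintype K] (hK : Fintype.card K = p ^ a)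
    (e : ℕ) (he : 0 < e)
    (u : Fin e → (Fin e → K)) (hu : u = fun i => Pi.single i (1 : K))
    (A D D₀ S Fsub G : Subgroup (GL (Fin e) K))
    (hA : A = (Units.map (Matrix.scalar (Fin e) :
      K →+* Matrix (Fin e) (Fin e) K).toMonoidHom).range)
    (hDdiag : ∀ d ∈ D, (d : Matrix (Fin e) (Fin e) K).IsDiag)
    (hAD : A ≤ D)
    (hD₀ : ∀ g : GL (Fin e) K, g ∈ D₀ ↔
      (g ∈ D ∧ (g : Matrix (Fin e) (Fin e) K) *ᵥ u ⟨0, he⟩ = u ⟨0, he⟩))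
    (hADinf : A ⊓ D₀ = ⊥) (hADsup : A ⊔ D₀ = D)
    (hSperm : ∀ s ∈ S, ∃ σ : Equiv.Perm (Fin e),
      ∀ j, (s : Matrix (Fin e) (Fin e) K) *ᵥ u j = u (σ j))
    (hSreg : ∀ i j : Fin e, ∃! s : GL (Fin e) K,
      s ∈ S ∧ (s : Matrix (Fin e) (Fin e) K) *ᵥ u i = u j)
    (hF : Fsub = D ⊔ S)
    (hDnorm : ∀ f ∈ Fsub, ∀ d ∈ D, f * d * f⁻¹ ∈ D)
    (hpermS : ∀ g ∈ Fsub, (∃ σ : Equiv.Perm (Fin e),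
      ∀ j, (g : Matrix (Fin e) (Fin e) K) *ᵥ u j = u (σ j)) → g ∈ S)
    (hnoneq : ∀ i j : Fin e, i ≠ j → ∃ d ∈ D₀,
      (d : Matrix (Fin e) (Fin e) K) i i ≠ (d : Matrix (Fin e) (Fin e) K) j j)
    (hhalf : ∀ d ∈ D, d ≠ 1 →
      2 * {i : Fin e | (d : Matrix (Fin e) (Fin e) K) i i = 1}.ncard ≤ e)
    (hFG : Fsub ≤ G)
    (hFnormal : ∀ g ∈ G, ∀ f ∈ Fsub, g * f * g⁻¹ ∈ Fsub)
    (hGcop : Nat.Coprime (Nat.card G) p) :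
    ∀ g ∈ G, (g : Matrix (Fin e) (Fin e) K) *ᵥ u ⟨0, he⟩ = u ⟨0, he⟩ →
      (∀ d : GL (Fin e) K, d ∈ D₀ ↔ g⁻¹ * d * g ∈ D₀) ∧
      ∃ δ πg : GL (Fin e) K,
        (δ : Matrix (Fin e) (Fin e) K).IsDiag ∧
        (∃ σ : Equiv.Perm (Fin e),
          ∀ j, (πg : Matrix (Fin e) (Fin e) K) *ᵥ u j = u (σ j)) ∧
        g = δ * πg ∧
        (∀ δ' πg' : GL (Fin e) K, (δ' : Matrix (Fin e) (Fin e) K).IsDiag →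
          (∃ σ : Equiv.Perm (Fin e),
            ∀ j, (πg' : Matrix (Fin e) (Fin e) K) *ᵥ u j = u (σ j)) →
          g = δ' * πg' → δ' = δ ∧ πg' = πg) ∧
        (∀ s ∈ S, πg * s * πg⁻¹ ∈ S ∧ πg⁻¹ * s * πg ∈ S) ∧
        (∀ f ∈ Fsub, δ * f * δ⁻¹ ∈ Fsub) ∧
        (∀ f ∈ Fsub, πg * f * πg⁻¹ ∈ Fsub) ∧
        (∀ s ∈ S, δ⁻¹ * s⁻¹ * δ * s ∈ D) ∧
        (δ ≠ 1 →
          4 * {i : Fin e | (δ : Matrix (Fin e) (Fin e) K) i i = 1}.ncard ≤ 3 * e) := by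
  subst hu
  set i₀ : Fin e := ⟨0, he⟩
  beta_reduce at hD₀ hSreg ⊢
  replace hDdiag : D ≤ (diagHom (n := Fin e) (K := K)).range :=
    fun d hd => isDiag_iff.1 (hDdiag d hd)
  replace hSperm : S ≤ (permHom (n := Fin e) (K := K)).range :=
    fun s hs => perm_iff.1 (hSperm s hs)
  have hDF : D ≤ Fsub := hF ▸ le_sup_left
  have hSF : S ≤ Fsub := hF ▸ le_sup_right
  have hD₀D : D₀ ≤ D := fun d hd => ((hD₀ d).1 hd).1
  have hSnorm : S ≤ Subgroup.normalizer (D : Set (GL (Fin e) K)) := fun s hs =>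
    Subgroup.mem_normalizer_iff.2 fun d => ⟨hDnorm s (hSF hs) d, fun h => by
      simpa [mul_assoc] using hDnorm s⁻¹ (hSF (inv_mem hs)) _ h⟩
  have hdec : ∀ f ∈ Fsub, ∃ d ∈ D, ∃ s ∈ S, d * s = f := by
    intro f hf
    have : f ∈ ((D ⊔ S : Subgroup (GL (Fin e) K)) : Set (GL (Fin e) K)) := hF ▸ hf
    rw [Subgroup.coe_mul_of_right_le_normalizer_left D S hSnorm] at this
    exact Set.mem_mul.1 this
  have hstab : ∀ f ∈ Fsub, (f : Matrix (Fin e) (Fin e) K) *ᵥ Pi.single i₀ 1 = Pi.single i₀ 1 →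
      f ∈ D₀ := by
    intro f hf hfix
    obtain ⟨d, hd, s, hs, rfl⟩ := hdec f hf
    refine (hD₀ _).2 ⟨?_, hfix⟩
    obtain ⟨c, rfl⟩ := hDdiag hd
    obtain ⟨σ, rfl⟩ := hSperm hs
    rw [monomial_mulVec_single] at hfix
    have hσ : σ i₀ = i₀ := by
      by_contra hne
      have := congrFun hfix i₀
      simp [Pi.single_eq_of_ne (Ne.symm hne)] at this
    have h1 := (hSreg i₀ i₀).unique ⟨hs, by rw [permHom_mulVec_single, hσ]⟩
      ⟨one_mem S, by rw [Units.val_one, Matrix.one_mulVec]⟩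
    rwa [h1, mul_one]
  have hconj : ∀ g ∈ G, (g : Matrix (Fin e) (Fin e) K) *ᵥ Pi.single i₀ 1 = Pi.single i₀ 1 →
      ∀ d ∈ D₀, g * d * g⁻¹ ∈ D₀ := by
    intro g hg hfix d hd
    refine hstab _ (hFnormal g hg d (hDF (hD₀D hd))) ?_
    rw [Units.val_mul, Units.val_mul, ← Matrix.mulVec_mulVec, ← Matrix.mulVec_mulVec,
      inv_mulVec_eq_self hfix, ((hD₀ d).1 hd).2, hfix]
  intro g hg hfix
  have hgD₀ : ∀ d ∈ D₀, g * d * g⁻¹ ∈ D₀ := hconj g hg hfix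
  have hgD₀' : ∀ d ∈ D₀, g⁻¹ * d * g ∈ D₀ := by
    simpa using hconj g⁻¹ (inv_mem hg) (inv_mulVec_eq_self hfix)
  refine ⟨fun d => ⟨hgD₀' d, fun h => by simpa [mul_assoc] using hgD₀ _ h⟩, ?_⟩
  obtain ⟨c, σ, rfl⟩ := exists_monomial (hD₀D.trans hDdiag) hnoneq hgD₀'
  have hgD : ∀ d ∈ D, (diagHom c * permHom σ) * d * (diagHom c * permHom σ)⁻¹ ∈ D := by
    have : D ≤ D.comap (MulAut.conj (diagHom c * permHom σ)).toMonoidHom := by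
      conv_lhs => rw [← hADsup]
      refine sup_le (fun z hz => ?_) (fun d hd => hD₀D (hgD₀ d hd))
      have hzD := hAD hz
      rw [hA] at hz
      obtain ⟨k, rfl⟩ := hz
      have hcomm : ∀ x : GL (Fin e) K,
          Commute x (Units.map (Matrix.scalar (Fin e) :
            K →+* Matrix (Fin e) (Fin e) K).toMonoidHom k) := fun x =>
        Units.ext (Matrix.scalar_commute (k : K) (Commute.all _)
          (x : Matrix (Fin e) (Fin e) K)).symm.eq
      change (diagHom c * permHom σ) * _ * (diagHom c * permHom σ)⁻¹ ∈ D
      rwa [(hcomm _).eq, mul_inv_cancel_right]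
    exact fun d hd => this hd
  have hπS : ∀ s ∈ S, permHom σ * s * (permHom σ)⁻¹ ∈ S := fun s hs =>
    (conj_mem_of_monomial hDdiag hSperm hSF hdec (hFnormal _ hg) hs).1
  have hπS' : ∀ s ∈ S, (permHom σ)⁻¹ * s * permHom σ ∈ S := by
    intro s hs
    have hginv : (diagHom c * permHom σ : GL (Fin e) K)⁻¹ =
        diagHom (c⁻¹ ∘ ⇑(σ⁻¹)⁻¹) * permHom σ⁻¹ := by
      rw [← permHom_mul_diagHom, _root_.mul_inv_rev, map_inv, map_inv]
    have := (conj_mem_of_monomial hDdiag hSperm hSF hdec (c := c⁻¹ ∘ ⇑(σ⁻¹)⁻¹) (σ := σ⁻¹)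
      (by rw [← hginv]; exact hFnormal _ (inv_mem hg)) hs).1
    simpa using this
  have hδS : ∀ s ∈ S, diagHom c * s * (diagHom c)⁻¹ * s⁻¹ ∈ D := by
    intro s hs
    simpa [mul_assoc] using
      (conj_mem_of_monomial hDdiag hSperm hSF hdec (hFnormal _ hg) (hπS' s hs)).2
  have hδD : ∀ d ∈ D, diagHom c * d * (diagHom c)⁻¹ = d := fun d hd => by
    rw [(diagHom_commute ⟨c, rfl⟩ (hDdiag hd)).eq, mul_inv_cancel_right]
  have hδS' : ∀ s ∈ S, (diagHom c)⁻¹ * s⁻¹ * diagHom c * s ∈ D := by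
    intro s hs
    have h := inv_mem (hδS s⁻¹ (inv_mem hs))
    have h' : (diagHom c)⁻¹ * (diagHom c * s⁻¹ * (diagHom c)⁻¹ * s⁻¹⁻¹)⁻¹ * diagHom c ∈ D := by
      rwa [(diagHom_commute (inv_mem ⟨c, rfl⟩) (hDdiag h)).eq, inv_mul_cancel_right]
    simpa [mul_assoc] using h'
  have hcF : ∀ f ∈ Fsub, diagHom c * f * (diagHom c)⁻¹ ∈ Fsub := by
    have : Fsub ≤ Fsub.comap (MulAut.conj (diagHom c)).toMonoidHom := by
      conv_lhs => rw [hF]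
      refine sup_le (fun d hd => ?_) (fun s hs => ?_)
      · change diagHom c * d * (diagHom c)⁻¹ ∈ Fsub
        rw [hδD d hd]
        exact hDF hd
      · change diagHom c * s * (diagHom c)⁻¹ ∈ Fsub
        simpa using mul_mem (hDF (hδS s hs)) (hSF hs)
    exact fun f hf => this hf
  have hπF : ∀ f ∈ Fsub, permHom σ * f * (permHom σ)⁻¹ ∈ Fsub := by
    have : Fsub ≤ Fsub.comap (MulAut.conj (permHom σ)).toMonoidHom := by
      conv_lhs => rw [hF]
      refine sup_le (fun d hd => ?_) (fun s hs => hSF (hπS s hs))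
      have h := hgD d hd
      have h' : (diagHom c)⁻¹ * ((diagHom c * permHom σ) * d * (diagHom c * permHom σ)⁻¹) *
          diagHom c ∈ D := by
        rwa [(diagHom_commute (inv_mem ⟨c, rfl⟩) (hDdiag h)).eq, inv_mul_cancel_right]
      exact hDF (by simpa [mul_assoc] using h')
    exact fun f hf => this hf
  refine ⟨diagHom c, permHom σ, isDiag_iff.2 ⟨c, rfl⟩, perm_iff.2 ⟨σ, rfl⟩, rfl, ?_,
    fun s hs => ⟨hπS s hs, hπS' s hs⟩, hcF, hπF, hδS', ?_⟩
  · intro δ' π' hδ' hπ' h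
    obtain ⟨c', rfl⟩ := isDiag_iff.1 hδ'
    obtain ⟨σ', rfl⟩ := perm_iff.1 hπ'
    obtain ⟨rfl, rfl⟩ := monomial_inj h
    exact ⟨rfl, rfl⟩
  · intro hne
    have hfix' := hfix
    rw [monomial_mulVec_single] at hfix'
    have hσ : σ i₀ = i₀ := by
      by_contra h
      have := congrFun hfix' i₀
      simp [Pi.single_eq_of_ne (Ne.symm h)] at this
    have hc : c i₀ = 1 := by
      have := congrFun hfix' i₀
      rw [hσ] at this
      simpa using this
    have key := four_mul_ncard_le (T := {τ | permHom τ ∈ S}) hc (fun i => ?_)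
      (fun τ hτ hex => ?_) (fun h => hne (by rw [h, map_one]))
    · simpa [coe_diagHom] using key
    · obtain ⟨s, ⟨hs, hsi⟩, -⟩ := hSreg i₀ i
      obtain ⟨τ, rfl⟩ := hSperm hs
      refine ⟨τ, hs, ?_⟩
      rw [permHom_mulVec_single] at hsi
      by_contra h
      have := congrFun hsi i
      simp [Pi.single_eq_of_ne (Ne.symm h)] at this
    · have h := hδS' _ hτ
      rw [diagHom_mul_conj_permHom] at h
      obtain ⟨i, hi⟩ := hex
      have hcard := hhalf _ h (fun h1 => hi ?_)
      · rw [Fintype.card_fin]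
        have hset : {j | c (τ j) = c j} =
            {j | ((diagHom fun i => (c i)⁻¹ * c (τ i) : GL (Fin e) K) :
            Matrix (Fin e) (Fin e) K) j j = 1} := by
          ext j
          rw [Set.mem_ofPred_eq, Set.mem_ofPred_eq, coe_diagHom, Matrix.diagonal_apply_eq,
            Units.val_eq_one, inv_mul_eq_one, eq_comm]
        rwa [hset]
      · have := congrArg (fun x : GL (Fin e) K => (x : Matrix (Fin e) (Fin e) K) i i) h1
        simp only [coe_diagHom, Matrix.diagonal_apply_eq, Units.val_one, Matrix.one_apply_eq,
          Units.val_eq_one, inv_mul_eq_one] at this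
        exact this.symm
end

section
/- Let q = 3^k, V = F_q^4 with basis u_1, u_2, u_3, u_4, A ≤ GL(4, q) the group of scalar matrices, d_1 = diag(1, 1, -1, -1), d_2 = diag(1, -1, 1, -1), s_1 the permutation matrix swapping u_1↔u_2 and u_3↔u_4, s_2 the permutation matrix swapping u_1↔u_3 and u_2↔u_4, and F = A⟨d_1, d_2, s_1, s_2⟩. Let G be a finite group with F ⊴ G ≤ GL(4, q) and 3 not dividing |G|. Set x_1 = u_2 + u_3 + u_4 and y_1 = u_1. Then |C_G(x_1) ∩ C_G(y_1)| ≤ 2. Moreover, if there is a non-identity element g_0 ∈ C_G(x_1) ∩ C_G(y_1) with g_0(u_2) = u_2 (so g_0 is the permutation matrix fixing u_1, u_2 and swapping u_3↔u_4), then, setting x_2 = u_1 + u_2 + u_4, y_2 = u_1 + u_3, x_3 = u_1 + u_2 - u_4, y_3 = u_1 + u_3, either C_G(x_2) ∩ C_G(y_2) = 1 or C_G(x_3) ∩ C_G(y_3) = 1. -/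
open Matrix

/-- `M` has in row `i` the single entry `c i`, in column `σ i`. -/
def IsMonomialWith {K : Type*} [Field K] (M : Matrix (Fin 4) (Fin 4) K)
    (σ : Equiv.Perm (Fin 4)) (c : Fin 4 → K) : Prop :=
  ∀ v i, (M *ᵥ v) i = c i * v (σ i)

namespace IsMonomialWith

variable {K : Type*} [Field K] {M N : Matrix (Fin 4) (Fin 4) K} {σ τ : Equiv.Perm (Fin 4)}
  {c d : Fin 4 → K}

theorem one : IsMonomialWith (1 : Matrix (Fin 4) (Fin 4) K) 1 1 := by
  intro v i
  simp

theorem mul (hM : IsMonomialWith M σ c) (hN : IsMonomialWith N τ d) :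
    IsMonomialWith (M * N) (τ * σ) (fun i => c i * d (σ i)) := by
  intro v i
  rw [← mulVec_mulVec, hM, hN, Equiv.Perm.mul_apply, mul_assoc]

theorem inv {g : GL (Fin 4) K} (hg : IsMonomialWith (g : Matrix (Fin 4) (Fin 4) K) σ c)
    (hc : ∀ i, c i ≠ 0) :
    IsMonomialWith ((g⁻¹ : GL (Fin 4) K) : Matrix (Fin 4) (Fin 4) K) σ⁻¹
      (fun i => (c (σ⁻¹ i))⁻¹) := by
  intro v i
  have h := hg (((g⁻¹ : GL (Fin 4) K) : Matrix (Fin 4) (Fin 4) K) *ᵥ v) (σ⁻¹ i)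
  rw [mulVec_mulVec, Units.mul_inv, one_mulVec, ← Equiv.Perm.mul_apply, mul_inv_cancel,
    Equiv.Perm.one_apply] at h
  rw [h, inv_mul_cancel_left₀ (hc _)]

theorem exists_pow (hM : IsMonomialWith M σ c) (hc : ∀ i, c i ≠ 0) (n : ℕ) :
    ∃ d : Fin 4 → K, (∀ i, d i ≠ 0) ∧ IsMonomialWith (M ^ n) (σ ^ n) d := by
  induction n with
  | zero => exact ⟨1, fun i => one_ne_zero, by simpa using one⟩
  | succ n ih =>
    obtain ⟨d, hd, h⟩ := ih
    refine ⟨_, fun i => mul_ne_zero (hc i) (hd (σ i)), ?_⟩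
    rw [pow_succ', pow_succ]
    exact hM.mul h

theorem perm_eq_one (hM : IsMonomialWith (1 : Matrix (Fin 4) (Fin 4) K) σ c) : σ = 1 := by
  ext1 i
  by_contra h
  have := hM (Pi.single i 1) i
  rw [one_mulVec, Pi.single_eq_same, Pi.single_eq_of_ne (by simpa using h), mul_zero] at this
  exact one_ne_zero this

theorem ext (hM : IsMonomialWith M σ c) (hN : IsMonomialWith N σ c) : M = N :=
  Matrix.ext_of_mulVec_single fun j => by
    ext i
    rw [hM, hN]

theorem perm_eq_one_of_pow_three {g : GL (Fin 4) K}
    (hg : IsMonomialWith (g : Matrix (Fin 4) (Fin 4) K) σ c) (hc : ∀ i, c i ≠ 0)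
    (h3 : ¬ 3 ∣ orderOf g) (hσ : σ ^ 3 = 1) : σ = 1 := by
  obtain ⟨d, -, h⟩ := hg.exists_pow hc (orderOf g)
  rw [← Units.val_pow_eq_pow_val, pow_orderOf_eq_one, Units.val_one] at h
  have h₁ : orderOf σ ∣ orderOf g := orderOf_dvd_of_pow_eq_one h.perm_eq_one
  have h₂ : orderOf σ ∣ 3 := orderOf_dvd_of_pow_eq_one hσ
  rcases (Nat.dvd_prime Nat.prime_three).1 h₂ with h | h
  · exact orderOf_eq_one_iff.1 h
  · exact absurd (h ▸ h₁) h3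

end IsMonomialWith

section Monomial

variable {K : Type*} [Field K]

/-- Monomial matrices whose permutation part lies in the (self-centralizing) Klein four group
and whose nonzero entries agree up to sign. -/
def signedKlein (K : Type*) [Field K] : Subgroup (GL (Fin 4) K) where
  carrier := {g | ∃ (σ : Equiv.Perm (Fin 4)) (c : Fin 4 → K),
    (σ ∈ Subgroup.centralizer {Equiv.swap 0 1 * Equiv.swap 2 3, Equiv.swap 0 2 * Equiv.swap 1 3}) ∧
    (∀ i, c i ≠ 0) ∧ (∀ i j, c i ^ 2 = c j ^ 2) ∧
    IsMonomialWith (g : Matrix (Fin 4) (Fin 4) K) σ c}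
  one_mem' := ⟨1, 1, one_mem _, by simp, by simp, IsMonomialWith.one⟩
  mul_mem' := by
    rintro g h ⟨σ, c, hσ, hc, hc', hg⟩ ⟨τ, d, hτ, hd, hd', hh⟩
    refine ⟨_, _, mul_mem hτ hσ, fun i => mul_ne_zero (hc i) (hd _), fun i j => ?_, hg.mul hh⟩
    rw [mul_pow, mul_pow, hc' i j, hd' (σ i) (σ j)]
  inv_mem' := by
    rintro g ⟨σ, c, hσ, hc, hc', hg⟩
    refine ⟨_, _, inv_mem hσ, fun i => inv_ne_zero (hc _), fun i j => ?_, hg.inv hc⟩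
    rw [inv_pow, inv_pow, hc' (σ⁻¹ i) (σ⁻¹ j)]

theorem perm_eq_one_of_mem_centralizer {σ : Equiv.Perm (Fin 4)}
    (hσ : σ ∈ Subgroup.centralizer
      {Equiv.swap 0 1 * Equiv.swap 2 3, Equiv.swap 0 2 * Equiv.swap 1 3})
    (h0 : σ 0 = 0) : σ = 1 := by
  have h₁ := Subgroup.mem_centralizer_iff.1 hσ (Equiv.swap 0 1 * Equiv.swap 2 3) (by simp)
  have h₂ := Subgroup.mem_centralizer_iff.1 hσ (Equiv.swap 0 2 * Equiv.swap 1 3) (by simp)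
  clear hσ
  revert σ
  decide

theorem isMonomialWith_fix_zero {M : Matrix (Fin 4) (Fin 4) K} {σ : Equiv.Perm (Fin 4)}
    {c : Fin 4 → K} (hM : IsMonomialWith M σ c) (hu : M *ᵥ ![1,0,0,0] = ![1,0,0,0]) :
    σ 0 = 0 ∧ c 0 = 1 := by
  have h := hM ![1,0,0,0] 0
  rw [hu] at h
  generalize σ 0 = j at h ⊢
  fin_cases j <;> simp_all

theorem isMonomialWith_of_row {g : GL (Fin 4) K}
    (hrow : ∀ i j j', (g : Matrix (Fin 4) (Fin 4) K) i j ≠ 0 →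
      (g : Matrix (Fin 4) (Fin 4) K) i j' ≠ 0 → j = j') :
    ∃ (σ : Equiv.Perm (Fin 4)) (c : Fin 4 → K), (∀ i, c i ≠ 0) ∧
      IsMonomialWith (g : Matrix (Fin 4) (Fin 4) K) σ c := by
  have hsupp : ∀ i, ∃ j, ∀ j', j' ≠ j → (g : Matrix (Fin 4) (Fin 4) K) i j' = 0 := by
    intro i
    by_cases h : ∃ j, (g : Matrix (Fin 4) (Fin 4) K) i j ≠ 0
    · obtain ⟨j, hj⟩ := h
      exact ⟨j, fun j' hj' => by_contra fun h => hj' (hrow i j' j h hj)⟩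
    · push Not at h
      exact ⟨0, fun j' _ => h j'⟩
  choose s hs using hsupp
  have hmul : ∀ v i, ((g : Matrix (Fin 4) (Fin 4) K) *ᵥ v) i =
      (g : Matrix (Fin 4) (Fin 4) K) i (s i) * v (s i) := by
    intro v i
    rw [mulVec, dotProduct]
    exact Finset.sum_eq_single _ (fun j _ hj => by rw [hs i j hj, zero_mul]) (by simp)
  have hsurj : ∀ w, ∃ v, (g : Matrix (Fin 4) (Fin 4) K) *ᵥ v = w := fun w =>
    ⟨((g⁻¹ : GL (Fin 4) K) : Matrix (Fin 4) (Fin 4) K) *ᵥ w, by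
      rw [mulVec_mulVec, Units.mul_inv, one_mulVec]⟩
  have hne : ∀ i, (g : Matrix (Fin 4) (Fin 4) K) i (s i) ≠ 0 := by
    intro i h
    obtain ⟨v, hv⟩ := hsurj (Pi.single i 1)
    have := hmul v i
    rw [hv, h, zero_mul, Pi.single_eq_same] at this
    exact one_ne_zero this
  have hinj : Function.Injective s := by
    intro i j hij
    by_contra hne'
    obtain ⟨v, hv⟩ := hsurj (Pi.single i 1)
    have h₁ := hmul v i
    have h₂ := hmul v j
    rw [hv, Pi.single_eq_same] at h₁
    rw [hv, Pi.single_eq_of_ne (Ne.symm hne'), ← hij] at h₂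
    rcases mul_eq_zero.1 h₂.symm with h | h
    · exact hne j (hij ▸ h)
    · rw [h, mul_zero] at h₁
      exact one_ne_zero h₁
  exact ⟨Equiv.ofBijective s (Finite.injective_iff_bijective.1 hinj), _, hne, hmul⟩

/-- A matrix fixing `u₁` that conjugates `d₁`, `d₂` into `signedKlein K` is monomial. -/
theorem isMonomialWith_of_conj_mem [NeZero (2 : K)] {g d₁ d₂ : GL (Fin 4) K}
    (hd₁ : (d₁ : Matrix (Fin 4) (Fin 4) K) = Matrix.diagonal ![1, 1, -1, -1])
    (hd₂ : (d₂ : Matrix (Fin 4) (Fin 4) K) = Matrix.diagonal ![1, -1, 1, -1])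
    (h₁ : g * d₁ * g⁻¹ ∈ signedKlein K) (h₂ : g * d₂ * g⁻¹ ∈ signedKlein K)
    (hu : (g : Matrix (Fin 4) (Fin 4) K) *ᵥ ![1,0,0,0] = ![1,0,0,0]) :
    ∃ (σ : Equiv.Perm (Fin 4)) (c : Fin 4 → K), (∀ i, c i ≠ 0) ∧
      IsMonomialWith (g : Matrix (Fin 4) (Fin 4) K) σ c ∧ σ 0 = 0 ∧ c 0 = 1 := by
  have key : ∀ (d : GL (Fin 4) K) (e : Fin 4 → K), e 0 = 1 →
      (d : Matrix (Fin 4) (Fin 4) K) = Matrix.diagonal e → g * d * g⁻¹ ∈ signedKlein K →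
      ∃ c : Fin 4 → K, ∀ i j, (g : Matrix (Fin 4) (Fin 4) K) i j ≠ 0 → e j = c i := by
    rintro d e he hd ⟨σ, c, hσ, -, -, hm⟩
    have hfix : ((g * d * g⁻¹ : GL (Fin 4) K) : Matrix (Fin 4) (Fin 4) K) *ᵥ ![1,0,0,0] =
        ![1,0,0,0] := by
      have hdu : (d : Matrix (Fin 4) (Fin 4) K) *ᵥ ![1,0,0,0] = ![1,0,0,0] := by
        rw [hd]
        ext i
        rw [mulVec_diagonal]
        fin_cases i <;> simp [he]
      have hinv : ((g⁻¹ : GL (Fin 4) K) : Matrix (Fin 4) (Fin 4) K) *ᵥ ![1,0,0,0] =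
          ![1,0,0,0] := by
        conv_lhs => rw [← hu]
        rw [mulVec_mulVec, Units.inv_mul, one_mulVec]
      rw [Units.val_mul, Units.val_mul, ← mulVec_mulVec, hinv, ← mulVec_mulVec, hdu, hu]
    obtain rfl := perm_eq_one_of_mem_centralizer hσ (isMonomialWith_fix_zero hm hfix).1
    refine ⟨c, fun i j hij => ?_⟩
    have h := hm ((g : Matrix (Fin 4) (Fin 4) K) *ᵥ Pi.single j 1) i
    rw [mulVec_mulVec, ← Units.val_mul, inv_mul_cancel_right, Units.val_mul, hd,
      mulVec_single_one, mulVec_single_one, col_apply, mul_diagonal, Equiv.Perm.one_apply,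
      col_apply, mul_comm] at h
    exact mul_right_cancel₀ hij h
  obtain ⟨c₁, hc₁⟩ := key d₁ _ rfl hd₁ h₁
  obtain ⟨c₂, hc₂⟩ := key d₂ _ rfl hd₂ h₂
  have hneg : (1 : K) ≠ -1 := fun h => two_ne_zero (α := K) (by linear_combination h)
  obtain ⟨σ, c, hc, hm⟩ := isMonomialWith_of_row (g := g) fun i j j' hj hj' => by
    have e₁ := (hc₁ i j hj).trans (hc₁ i j' hj').symm
    have e₂ := (hc₂ i j hj).trans (hc₂ i j' hj').symm
    clear hj hj'
    fin_cases j <;> fin_cases j' <;> simp_all [Ne.symm hneg]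
  exact ⟨σ, c, hc, hm, isMonomialWith_fix_zero hm hu⟩

/-- A monomial matrix fixing `u₁` and `u₂ + u₃ + u₄` is a permutation matrix. -/
theorem coeff_eq_one {M : Matrix (Fin 4) (Fin 4) K} {σ : Equiv.Perm (Fin 4)}
    {c : Fin 4 → K} (hM : IsMonomialWith M σ c) (hc0 : c 0 = 1)
    (hx : M *ᵥ ![0,1,1,1] = ![0,1,1,1]) : c = 1 := by
  ext i
  have h := hM ![0,1,1,1] i
  rw [hx] at h
  generalize σ i = j at h
  fin_cases i <;> fin_cases j <;> simp_all

/-- If conjugation by a diagonal matrix maps `s₁` into `signedKlein K`, this constrains the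
diagonal entries. -/
theorem sq_mul_sq_eq_of_conj_mem {g s₁ : GL (Fin 4) K} {c : Fin 4 → K} (hc : ∀ i, c i ≠ 0)
    (hg : IsMonomialWith (g : Matrix (Fin 4) (Fin 4) K) 1 c)
    (hs₁ : (s₁ : Matrix (Fin 4) (Fin 4) K) = !![0,1,0,0; 1,0,0,0; 0,0,0,1; 0,0,1,0])
    (h : g * s₁ * g⁻¹ ∈ signedKlein K) : (c 0 * c 3) ^ 2 = (c 1 * c 2) ^ 2 := by
  obtain ⟨σ, d, hσ, hd, hd', hm⟩ := h
  have hs : IsMonomialWith (s₁ : Matrix (Fin 4) (Fin 4) K)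
      (Equiv.swap 0 1 * Equiv.swap 2 3) 1 := by
    intro v i
    rw [hs₁]
    fin_cases i <;> simp [mulVec, dotProduct, Fin.sum_univ_four] <;> rfl
  have hgs := (hg.mul hs).mul (hg.inv hc)
  rw [← Units.val_mul, ← Units.val_mul] at hgs
  have h₀ := (hgs (fun _ => 1) 0).symm.trans (hm _ 0)
  have h₂ := (hgs (fun _ => 1) 2).symm.trans (hm _ 2)
  have e₀ : (Equiv.swap 0 1 * Equiv.swap 2 3 : Equiv.Perm (Fin 4)) 0 = 1 := by decide
  have e₂ : (Equiv.swap 0 1 * Equiv.swap 2 3 : Equiv.Perm (Fin 4)) 2 = 3 := by decide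
  simp only [mul_one, inv_one, Equiv.Perm.one_apply, Pi.one_apply, e₀, e₂] at h₀ h₂
  have := hd' 0 2
  rw [← h₀, ← h₂] at this
  have h1 := hc 1
  have h3 := hc 3
  field_simp at this
  linear_combination this

/-- Monomial matrices fixing `u₁` and `-u₁ - u₂ + u₃`. -/
theorem perm_cases_of_fix_third {M : Matrix (Fin 4) (Fin 4) K} {σ : Equiv.Perm (Fin 4)}
    {c : Fin 4 → K} (hc : ∀ i, c i ≠ 0) (hM : IsMonomialWith M σ c) (h0 : σ 0 = 0) (hc0 : c 0 = 1)
    (hsq : σ = 1 → (c 0 * c 3) ^ 2 = (c 1 * c 2) ^ 2)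
    (hx : M *ᵥ ![-1,-1,1,0] = ![-1,-1,1,0]) :
    σ = Equiv.swap 1 2 ∨ (σ = 1 ∧ (c = ![1,1,1,1] ∨ c = ![1,1,1,-1])) := by
  have h := hM ![-1,-1,1,0]
  rw [hx] at h
  have h3 : σ 3 = 3 := by
    have h := h 3
    generalize σ 3 = j at h ⊢
    fin_cases j <;> first | rfl | exact absurd h (by simp [hc 3, (hc 3).symm])
  have hσ : σ = Equiv.swap 1 2 ∨ σ = 1 := by
    clear hM hsq h
    revert σ
    decide
  refine hσ.imp_right fun h1 => ⟨h1, ?_⟩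
  have e1 := h 1
  have e2 := h 2
  have e3 := hsq h1
  simp only [h1, Equiv.Perm.one_apply, cons_val] at e1 e2
  have f1 : c 1 = 1 := by linear_combination e1
  have f2 : c 2 = 1 := by linear_combination - e2
  have f3 : c 3 = 1 ∨ c 3 = -1 := by
    rw [hc0, f1, f2] at e3
    exact mul_self_eq_one_iff.1 (by linear_combination e3)
  refine f3.imp (fun f3 => ?_) (fun f3 => ?_) <;> ext i <;> fin_cases i <;> simp [hc0, f1, f2, f3]

/-- Monomial matrices fixing `u₁` and `-u₁ - u₂ + u₄`. -/
theorem perm_cases_of_fix_fourth {M : Matrix (Fin 4) (Fin 4) K} {σ : Equiv.Perm (Fin 4)}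
    {c : Fin 4 → K} (hc : ∀ i, c i ≠ 0) (hM : IsMonomialWith M σ c) (h0 : σ 0 = 0) (hc0 : c 0 = 1)
    (hsq : σ = 1 → (c 0 * c 3) ^ 2 = (c 1 * c 2) ^ 2)
    (hx : M *ᵥ ![-1,-1,0,1] = ![-1,-1,0,1]) :
    σ = Equiv.swap 1 3 ∨ (σ = 1 ∧ (c = ![1,1,1,1] ∨ c = ![1,1,-1,1])) := by
  have h := hM ![-1,-1,0,1]
  rw [hx] at h
  have h2 : σ 2 = 2 := by
    have h := h 2
    generalize σ 2 = j at h ⊢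
    fin_cases j <;> first | rfl | exact absurd h (by simp [hc 2, (hc 2).symm])
  have hσ : σ = Equiv.swap 1 3 ∨ σ = 1 := by
    clear hM hsq h
    revert σ
    decide
  refine hσ.imp_right fun h1 => ⟨h1, ?_⟩
  have e1 := h 1
  have e2 := h 3
  have e3 := hsq h1
  simp only [h1, Equiv.Perm.one_apply, cons_val] at e1 e2
  have f1 : c 1 = 1 := by linear_combination e1
  have f2 : c 3 = 1 := by linear_combination - e2
  have f3 : c 2 = 1 ∨ c 2 = -1 := by
    rw [hc0, f1, f2] at e3
    exact mul_self_eq_one_iff.1 (by linear_combination - e3)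
  refine f3.imp (fun f3 => ?_) (fun f3 => ?_) <;> ext i <;> fin_cases i <;> simp [hc0, f1, f2, f3]

theorem isMonomialWith_diagonal (c : Fin 4 → K) : IsMonomialWith (Matrix.diagonal c) 1 c :=
  fun v i => mulVec_diagonal c v i

/-- Matrix of the simultaneous eigenbasis of `d₂` and `s₂`; it normalizes `F`. -/
def eigenMatrix (K : Type*) [Field K] : Matrix (Fin 4) (Fin 4) K :=
  !![1,1,0,0; 0,0,1,1; 1,-1,0,0; 0,0,1,-1]

theorem isUnit_eigenMatrix [NeZero (2 : K)] : IsUnit (eigenMatrix K) := by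
  rw [isUnit_iff_isUnit_det, isUnit_iff_ne_zero]
  have : (eigenMatrix K).det = -2 ^ 2 := by
    simp [eigenMatrix, det_succ_row_zero, Fin.sum_univ_succ, Fin.succAbove]
    norm_num
  rw [this]
  exact neg_ne_zero.2 (pow_ne_zero 2 two_ne_zero)

theorem eigenMatrix_mul_diagonal_one : eigenMatrix K * Matrix.diagonal ![1, 1, -1, -1] =
    Matrix.diagonal ![1, -1, 1, -1] * eigenMatrix K := by
  ext i j
  rw [eigenMatrix, mul_diagonal, diagonal_mul]
  fin_cases i <;> fin_cases j <;> simp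

theorem eigenMatrix_mul_diagonal_two : eigenMatrix K * Matrix.diagonal ![1, -1, 1, -1] =
    !![0,0,1,0; 0,0,0,1; 1,0,0,0; 0,1,0,0] * eigenMatrix K := by
  ext i j
  rw [eigenMatrix, mul_diagonal]
  fin_cases i <;> fin_cases j <;> simp [mul_apply, Fin.sum_univ_four]

theorem eigenMatrix_mul_swap_one :
    eigenMatrix K * !![0,1,0,0; 1,0,0,0; 0,0,0,1; 0,0,1,0] =
      Matrix.diagonal ![1, 1, -1, -1] * eigenMatrix K := by
  ext i j
  rw [eigenMatrix, diagonal_mul]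
  fin_cases i <;> fin_cases j <;> simp [mul_apply, Fin.sum_univ_four]

theorem eigenMatrix_mul_swap_two :
    eigenMatrix K * !![0,0,1,0; 0,0,0,1; 1,0,0,0; 0,1,0,0] =
      !![0,1,0,0; 1,0,0,0; 0,0,0,1; 0,0,1,0] * eigenMatrix K := by
  ext i j
  rw [eigenMatrix]
  fin_cases i <;> fin_cases j <;> simp [mul_apply, Fin.sum_univ_four]

theorem mul_eigenMatrix_eq_third : !![1,0,0,0; 0,0,0,-1; 0,0,1,0; 0,-1,0,0] * eigenMatrix K =
    eigenMatrix K * Matrix.diagonal ![1,1,-1,1] := by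
  ext i j
  rw [eigenMatrix, mul_diagonal]
  fin_cases i <;> fin_cases j <;> simp [mul_apply, Fin.sum_univ_four]

theorem mul_eigenMatrix_eq_fourth : !![1,0,0,0; 0,0,0,1; 0,0,1,0; 0,1,0,0] * eigenMatrix K =
    eigenMatrix K * Matrix.diagonal ![1,1,1,-1] := by
  ext i j
  rw [eigenMatrix, mul_diagonal]
  fin_cases i <;> fin_cases j <;> simp [mul_apply, Fin.sum_univ_four]

theorem isMonomialWith_neg_swap :
    IsMonomialWith (!![1,0,0,0; 0,0,0,-1; 0,0,1,0; 0,-1,0,0] : Matrix (Fin 4) (Fin 4) K)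
      (Equiv.swap 1 3) ![1,-1,1,-1] := by
  intro v i
  fin_cases i <;> simp [mulVec, dotProduct, Fin.sum_univ_four, Equiv.swap_apply_def]

theorem isMonomialWith_swap :
    IsMonomialWith (!![1,0,0,0; 0,0,0,1; 0,0,1,0; 0,1,0,0] : Matrix (Fin 4) (Fin 4) K)
      (Equiv.swap 1 3) 1 := by
  intro v i
  fin_cases i <;> simp [mulVec, dotProduct, Fin.sum_univ_four, Equiv.swap_apply_def]

theorem eigenMatrix_mulVec_first : eigenMatrix K *ᵥ ![1,0,0,0] = ![1,0,1,0] := by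
  ext i
  fin_cases i <;> simp [eigenMatrix, mulVec, dotProduct, Fin.sum_univ_four]

theorem eigenMatrix_mulVec_third (h3K : (3 : K) = 0) :
    eigenMatrix K *ᵥ ![-1,-1,1,0] = ![1,1,0,1] := by
  ext i
  fin_cases i <;> simp [eigenMatrix, mulVec, dotProduct, Fin.sum_univ_four]
  linear_combination - h3K

theorem eigenMatrix_mulVec_fourth (h3K : (3 : K) = 0) :
    eigenMatrix K *ᵥ ![-1,-1,0,1] = ![1,1,0,-1] := by
  ext i
  fin_cases i <;> simp [eigenMatrix, mulVec, dotProduct, Fin.sum_univ_four]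
  linear_combination - h3K

theorem scalar_sup_closure_le_signedKlein {d₁ d₂ s₁ s₂ : GL (Fin 4) K}
    (hd₁ : (d₁ : Matrix (Fin 4) (Fin 4) K) = Matrix.diagonal ![1, 1, -1, -1])
    (hd₂ : (d₂ : Matrix (Fin 4) (Fin 4) K) = Matrix.diagonal ![1, -1, 1, -1])
    (hs₁ : (s₁ : Matrix (Fin 4) (Fin 4) K) = !![0,1,0,0; 1,0,0,0; 0,0,0,1; 0,0,1,0])
    (hs₂ : (s₂ : Matrix (Fin 4) (Fin 4) K) = !![0,0,1,0; 0,0,0,1; 1,0,0,0; 0,1,0,0]) :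
    (Units.map (Matrix.scalar (Fin 4) : K →+* Matrix (Fin 4) (Fin 4) K).toMonoidHom).range ⊔
      Subgroup.closure {d₁, d₂, s₁, s₂} ≤ signedKlein K := by
  refine sup_le ?_ ((Subgroup.closure_le _).2 ?_)
  · rintro _ ⟨a, rfl⟩
    exact ⟨1, fun _ => a, one_mem _, fun _ => a.ne_zero, fun _ _ => rfl,
      isMonomialWith_diagonal _⟩
  · rintro _ (rfl | rfl | rfl | rfl)
    · refine ⟨1, ![1, 1, -1, -1], one_mem _, ?_, ?_, hd₁ ▸ isMonomialWith_diagonal _⟩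
      · simp [Fin.forall_fin_succ]
      · simp [Fin.forall_fin_succ]
    · refine ⟨1, ![1, -1, 1, -1], one_mem _, ?_, ?_, hd₂ ▸ isMonomialWith_diagonal _⟩
      · simp [Fin.forall_fin_succ]
      · simp [Fin.forall_fin_succ]
    · refine ⟨Equiv.swap 0 1 * Equiv.swap 2 3, 1, ?_, by simp, by simp, fun v i => ?_⟩
      · rw [Subgroup.mem_centralizer_iff]
        rintro _ (rfl | rfl) <;> decide
      · rw [hs₁]
        fin_cases i <;> simp [mulVec, dotProduct, Fin.sum_univ_four] <;> rfl
    · refine ⟨Equiv.swap 0 2 * Equiv.swap 1 3, 1, ?_, by simp, by simp, fun v i => ?_⟩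
      · rw [Subgroup.mem_centralizer_iff]
        rintro _ (rfl | rfl) <;> decide
      · rw [hs₂]
        fin_cases i <;> simp [mulVec, dotProduct, Fin.sum_univ_four] <;> rfl

end Monomial

theorem conj_mem_sup_closure {H : Type*} [Group H] {A : Subgroup H} {S : Set H} {e : H}
    (hA : A ≤ Subgroup.center H) (hS : ∀ s ∈ S, e * s * e⁻¹ ∈ S) {f : H}
    (hf : f ∈ A ⊔ Subgroup.closure S) : e * f * e⁻¹ ∈ A ⊔ Subgroup.closure S := by
  suffices h : A ⊔ Subgroup.closure S ≤
      (A ⊔ Subgroup.closure S).comap (MulAut.conj e).toMonoidHom from h hf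
  refine sup_le (fun a ha => ?_) ((Subgroup.closure_le _).2 fun s hs => ?_)
  · have : e * a * e⁻¹ = a := by rw [Subgroup.mem_center_iff.1 (hA ha) e, mul_inv_cancel_right]
    exact Subgroup.mem_sup_left (show e * a * e⁻¹ ∈ A from this.symm ▸ ha)
  · exact Subgroup.mem_sup_right (Subgroup.subset_closure (hS s hs))

theorem perm_eq_swap_of_fix_zero {σ : Equiv.Perm (Fin 4)} (h0 : σ 0 = 0) (h1 : σ ≠ 1)
    (h3 : σ ^ 3 = 1 → σ = 1) :
    σ = Equiv.swap 1 2 ∨ σ = Equiv.swap 1 3 ∨ σ = Equiv.swap 2 3 := by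
  revert σ
  decide

theorem perm_eq_of_no_three_cycle {σ τ : Equiv.Perm (Fin 4)} (hσ0 : σ 0 = 0) (hτ0 : τ 0 = 0)
    (hσ : σ ≠ 1) (hτ : τ ≠ 1) (hσ3 : σ ^ 3 = 1 → σ = 1) (hτ3 : τ ^ 3 = 1 → τ = 1)
    (hτσ : (τ * σ) ^ 3 = 1 → τ * σ = 1) : σ = τ := by
  rcases perm_eq_swap_of_fix_zero hσ0 hσ hσ3 with rfl | rfl | rfl <;>
    rcases perm_eq_swap_of_fix_zero hτ0 hτ hτ3 with rfl | rfl | rfl <;>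
    clear hσ0 hτ0 hσ hτ hσ3 hτ3 <;> revert hτσ <;> decide

/-- **Halasi–Podoski, Theorem 3.8 (the case `GL(4, 3^k)`).**
Let `q = 3^k`, `V = 𝔽_q^4` with standard basis `u₁,…,u₄`, `A ≤ GL(4,q)` the scalar matrices,
`d₁ = diag(1,1,-1,-1)`, `d₂ = diag(1,-1,1,-1)`, `s₁` the permutation matrix swapping
`u₁↔u₂, u₃↔u₄`, `s₂` the one swapping `u₁↔u₃, u₂↔u₄`, and `F = A⟨d₁,d₂,s₁,s₂⟩`.  Let
`F ⊴ G ≤ GL(4,q)` with `3 ∤ |G|`.  With `x₁ = u₂+u₃+u₄`, `y₁ = u₁` we have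
`|C_G(x₁) ∩ C_G(y₁)| ≤ 2`; and if some `g₀ ≠ 1` in `C_G(x₁) ∩ C_G(y₁)` fixes `u₂`, then for
`x₂ = u₁+u₂+u₄`, `y₂ = u₁+u₃`, `x₃ = u₁+u₂-u₄`, `y₃ = u₁+u₃`, either
`C_G(x₂) ∩ C_G(y₂) = 1` or `C_G(x₃) ∩ C_G(y₃) = 1`. -/
theorem base_for_GL4_char_three
    (kk : ℕ) (hkk : 0 < kk)
    (K : Type*) [Field K] [Fintype K] (hK : Fintype.card K = 3 ^ kk)
    (A : Subgroup (GL (Fin 4) K))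
    (hA : A = (Units.map (Matrix.scalar (Fin 4) :
      K →+* Matrix (Fin 4) (Fin 4) K).toMonoidHom).range)
    (d₁ d₂ s₁ s₂ : GL (Fin 4) K)
    (hd₁ : (d₁ : Matrix (Fin 4) (Fin 4) K) = Matrix.diagonal ![1, 1, -1, -1])
    (hd₂ : (d₂ : Matrix (Fin 4) (Fin 4) K) = Matrix.diagonal ![1, -1, 1, -1])
    (hs₁ : (s₁ : Matrix (Fin 4) (Fin 4) K) = !![0,1,0,0; 1,0,0,0; 0,0,0,1; 0,0,1,0])
    (hs₂ : (s₂ : Matrix (Fin 4) (Fin 4) K) = !![0,0,1,0; 0,0,0,1; 1,0,0,0; 0,1,0,0])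
    (Fsub G : Subgroup (GL (Fin 4) K))
    (hF : Fsub = A ⊔ Subgroup.closure {d₁, d₂, s₁, s₂})
    (hFG : Fsub ≤ G)
    (hFnormal : ∀ g ∈ G, ∀ f ∈ Fsub, g * f * g⁻¹ ∈ Fsub)
    (h3 : ¬ (3 ∣ Nat.card G)) :
    Nat.card {g : G // ((g : GL (Fin 4) K) : Matrix (Fin 4) (Fin 4) K) *ᵥ ![0,1,1,1] = ![0,1,1,1] ∧
        ((g : GL (Fin 4) K) : Matrix (Fin 4) (Fin 4) K) *ᵥ ![1,0,0,0] = ![1,0,0,0]} ≤ 2 ∧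
    ((∃ g₀ ∈ G, g₀ ≠ 1 ∧
        (g₀ : Matrix (Fin 4) (Fin 4) K) *ᵥ ![0,1,1,1] = ![0,1,1,1] ∧
        (g₀ : Matrix (Fin 4) (Fin 4) K) *ᵥ ![1,0,0,0] = ![1,0,0,0] ∧
        (g₀ : Matrix (Fin 4) (Fin 4) K) *ᵥ ![0,1,0,0] = ![0,1,0,0]) →
      ((∀ g ∈ G, (g : Matrix (Fin 4) (Fin 4) K) *ᵥ ![1,1,0,1] = ![1,1,0,1] →
          (g : Matrix (Fin 4) (Fin 4) K) *ᵥ ![1,0,1,0] = ![1,0,1,0] → g = 1) ∨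
       (∀ g ∈ G, (g : Matrix (Fin 4) (Fin 4) K) *ᵥ ![1,1,0,-1] = ![1,1,0,-1] →
          (g : Matrix (Fin 4) (Fin 4) K) *ᵥ ![1,0,1,0] = ![1,0,1,0] → g = 1))) := by
  classical
  have h3K : (3 : K) = 0 := by
    have h : ((Fintype.card K : ℕ) : K) = 0 := Nat.cast_card_eq_zero K
    rw [hK, Nat.cast_pow] at h
    exact_mod_cast pow_eq_zero_iff hkk.ne' |>.1 h
  have h2K : NeZero (2 : K) :=
    ⟨fun h => one_ne_zero (α := K) (by linear_combination h3K - h)⟩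
  have hord : ∀ g ∈ G, ¬ 3 ∣ orderOf g := fun g hg h =>
    h3 (h.trans (Subgroup.orderOf_dvd_natCard G hg))
  have hAc : A ≤ Subgroup.center _ := by
    rw [hA]
    rintro _ ⟨a, rfl⟩
    refine Subgroup.mem_center_iff.2 fun g => Units.ext ?_
    exact ((Matrix.scalar_commute (a : K) (fun r => mul_comm _ r) _).eq).symm
  have hFQ : Fsub ≤ signedKlein K := by
    rw [hF, hA]
    exact scalar_sup_closure_le_signedKlein hd₁ hd₂ hs₁ hs₂
  have hS : ∀ s ∈ ({d₁, d₂, s₁, s₂} : Set (GL (Fin 4) K)), s ∈ Fsub := fun s hs => by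
    rw [hF]
    exact Subgroup.mem_sup_right (Subgroup.subset_closure hs)
  have hmono : ∀ g : GL (Fin 4) K, (∀ f ∈ Fsub, g * f * g⁻¹ ∈ Fsub) →
      (g : Matrix (Fin 4) (Fin 4) K) *ᵥ ![1,0,0,0] = ![1,0,0,0] →
      ∃ (σ : Equiv.Perm (Fin 4)) (c : Fin 4 → K), (∀ i, c i ≠ 0) ∧
        IsMonomialWith (g : Matrix (Fin 4) (Fin 4) K) σ c ∧ σ 0 = 0 ∧ c 0 = 1 :=
    fun g hg hu => isMonomialWith_of_conj_mem hd₁ hd₂ (hFQ (hg _ (hS _ (by simp))))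
      (hFQ (hg _ (hS _ (by simp)))) hu
  have hperm : ∀ g ∈ G, (g : Matrix (Fin 4) (Fin 4) K) *ᵥ ![0,1,1,1] = ![0,1,1,1] →
      (g : Matrix (Fin 4) (Fin 4) K) *ᵥ ![1,0,0,0] = ![1,0,0,0] → g ≠ 1 →
      ∃ σ : Equiv.Perm (Fin 4),
        IsMonomialWith (g : Matrix (Fin 4) (Fin 4) K) σ 1 ∧ σ 0 = 0 ∧ σ ≠ 1 := by
    intro g hg hx hu hne
    obtain ⟨σ, c, hc, hm, h0, hc0⟩ := hmono g (hFnormal g hg) hu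
    obtain rfl := coeff_eq_one hm hc0 hx
    refine ⟨σ, hm, h0, ?_⟩
    rintro rfl
    exact hne (Units.ext (hm.ext IsMonomialWith.one))
  constructor
  · have huniq : ∀ g ∈ G, ∀ h ∈ G, g ≠ 1 → h ≠ 1 →
        (g : Matrix (Fin 4) (Fin 4) K) *ᵥ ![0,1,1,1] = ![0,1,1,1] →
        (g : Matrix (Fin 4) (Fin 4) K) *ᵥ ![1,0,0,0] = ![1,0,0,0] →
        (h : Matrix (Fin 4) (Fin 4) K) *ᵥ ![0,1,1,1] = ![0,1,1,1] →
        (h : Matrix (Fin 4) (Fin 4) K) *ᵥ ![1,0,0,0] = ![1,0,0,0] → g = h := by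
      intro g hg h hh hg1 hh1 hgx hgu hhx hhu
      obtain ⟨σ, hσ, hσ0, hσ1⟩ := hperm g hg hgx hgu hg1
      obtain ⟨τ, hτ, hτ0, hτ1⟩ := hperm h hh hhx hhu hh1
      have hστ := hσ.mul hτ
      rw [← Units.val_mul] at hστ
      have heq : σ = τ := perm_eq_of_no_three_cycle hσ0 hτ0 hσ1 hτ1
        (hσ.perm_eq_one_of_pow_three (by simp) (hord g hg))
        (hτ.perm_eq_one_of_pow_three (by simp) (hord h hh))
        (hστ.perm_eq_one_of_pow_three (by simp) (hord _ (mul_mem hg hh)))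
      subst heq
      exact Units.ext (hσ.ext hτ)
    let toBool : {g : G // ((g : GL (Fin 4) K) : Matrix (Fin 4) (Fin 4) K) *ᵥ ![0,1,1,1] =
        ![0,1,1,1] ∧ ((g : GL (Fin 4) K) : Matrix (Fin 4) (Fin 4) K) *ᵥ ![1,0,0,0] =
        ![1,0,0,0]} → Bool := fun g => decide ((g.1 : GL (Fin 4) K) = 1)
    have hinj : Function.Injective toBool := by
      rintro ⟨⟨g, hg⟩, hgx, hgu⟩ ⟨⟨h, hh⟩, hhx, hhu⟩ e
      have e : g = 1 ↔ h = 1 := by simpa [toBool] using e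
      have : g = h := by
        by_cases hg1 : g = 1
        · rw [hg1, e.1 hg1]
        · exact huniq g hg h hh hg1 (mt e.2 hg1) hgx hgu hhx hhu
      subst this
      rfl
    simpa using Nat.card_le_card_of_injective _ hinj
  · rintro ⟨g₀, hg₀, hg₀1, hg₀x, hg₀u, hg₀u'⟩
    obtain ⟨ρ, hρ, hρ0, hρ1⟩ := hperm g₀ hg₀ hg₀x hg₀u hg₀1
    have hρ' : ρ = Equiv.swap 2 3 := by
      have h := hρ ![0,1,0,0] 1
      rw [hg₀u'] at h
      have h1 : ρ 1 = 1 := by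
        generalize ρ 1 = j at h ⊢
        fin_cases j <;> simp_all
      clear hρ h
      revert ρ
      decide
    subst hρ'
    have hno : ∀ g ∈ G, ∀ c : Fin 4 → K, (∀ i, c i ≠ 0) →
        ¬ IsMonomialWith (g : Matrix (Fin 4) (Fin 4) K) (Equiv.swap 1 3) c := by
      intro g hg c hc hm
      have h := hm.mul hρ
      rw [← Units.val_mul] at h
      have := h.perm_eq_one_of_pow_three (by simpa using hc) (hord _ (mul_mem hg hg₀))
      revert this
      decide
    obtain ⟨E, hE⟩ := isUnit_eigenMatrix (K := K)
    have hE₁ : E * d₁ * E⁻¹ = d₂ := by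
      rw [mul_inv_eq_iff_eq_mul]
      refine Units.ext ?_
      rw [Units.val_mul, Units.val_mul, hE, hd₁, hd₂, eigenMatrix_mul_diagonal_one]
    have hE₂ : E * d₂ * E⁻¹ = s₂ := by
      rw [mul_inv_eq_iff_eq_mul]
      refine Units.ext ?_
      rw [Units.val_mul, Units.val_mul, hE, hd₂, hs₂, eigenMatrix_mul_diagonal_two]
    have hE₃ : E * s₁ * E⁻¹ = d₁ := by
      rw [mul_inv_eq_iff_eq_mul]
      refine Units.ext ?_
      rw [Units.val_mul, Units.val_mul, hE, hs₁, hd₁, eigenMatrix_mul_swap_one]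
    have hE₄ : E * s₂ * E⁻¹ = s₁ := by
      rw [mul_inv_eq_iff_eq_mul]
      refine Units.ext ?_
      rw [Units.val_mul, Units.val_mul, hE, hs₂, hs₁, eigenMatrix_mul_swap_two]
    have hEF : ∀ f ∈ Fsub, E * f * E⁻¹ ∈ Fsub := fun f hf => by
      rw [hF] at hf ⊢
      refine conj_mem_sup_closure hAc ?_ hf
      rintro _ (rfl | rfl | rfl | rfl)
      · simp [hE₁]
      · simp [hE₂]
      · simp [hE₃]
      · simp [hE₄]
    have hEF' : ∀ f ∈ Fsub, E⁻¹ * f * E ∈ Fsub := fun f hf => by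
      rw [hF] at hf ⊢
      rw [← inv_inv E, inv_inv E⁻¹]
      refine conj_mem_sup_closure hAc ?_ hf
      rintro _ (rfl | rfl | rfl | rfl)
      · rw [← hE₃]; simp [mul_assoc]
      · rw [← hE₁]; simp [mul_assoc]
      · rw [← hE₄]; simp [mul_assoc]
      · rw [← hE₂]; simp [mul_assoc]
    have hnorm : ∀ g ∈ G, ∀ f ∈ Fsub, (E⁻¹ * g * E) * f * (E⁻¹ * g * E)⁻¹ ∈ Fsub := by
      intro g hg f hf
      have := hEF' _ (hFnormal g hg _ (hEF f hf))
      simpa [mul_assoc] using this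
    have hfix : ∀ (g : GL (Fin 4) K) (v w : Fin 4 → K), eigenMatrix K *ᵥ v = w →
        (g : Matrix (Fin 4) (Fin 4) K) *ᵥ w = w →
        ((E⁻¹ * g * E : GL (Fin 4) K) : Matrix (Fin 4) (Fin 4) K) *ᵥ v = v := by
      rintro g v _ rfl h
      rw [← hE] at h
      rw [Units.val_mul, Units.val_mul, ← mulVec_mulVec, ← mulVec_mulVec, h, mulVec_mulVec,
        Units.inv_mul, one_mulVec]
    have hsq : ∀ g ∈ G, ∀ (σ : Equiv.Perm (Fin 4)) (c : Fin 4 → K), (∀ i, c i ≠ 0) →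
        IsMonomialWith ((E⁻¹ * g * E : GL (Fin 4) K) : Matrix (Fin 4) (Fin 4) K) σ c →
        σ = 1 → (c 0 * c 3) ^ 2 = (c 1 * c 2) ^ 2 := by
      rintro g hg _ c hc hm rfl
      exact sq_mul_sq_eq_of_conj_mem hc hm hs₁ (hFQ (hnorm g hg _ (hS _ (by simp))))
    have hback : ∀ (g : GL (Fin 4) K) (c : Fin 4 → K) (P : Matrix (Fin 4) (Fin 4) K),
        IsMonomialWith ((E⁻¹ * g * E : GL (Fin 4) K) : Matrix (Fin 4) (Fin 4) K) 1 c →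
        P * eigenMatrix K = eigenMatrix K * Matrix.diagonal c →
        (g : Matrix (Fin 4) (Fin 4) K) = P := by
      intro g c P hm hP
      rw [← hm.ext (isMonomialWith_diagonal c), ← hE, ← Units.val_mul] at hP
      have h : E * (E⁻¹ * g * E) = g * E := by simp [mul_assoc]
      rw [h, Units.val_mul] at hP
      exact (E.isUnit.mul_right_cancel hP).symm
    have hone : ∀ g : GL (Fin 4) K,
        IsMonomialWith ((E⁻¹ * g * E : GL (Fin 4) K) : Matrix (Fin 4) (Fin 4) K) 1 ![1,1,1,1] →
        g = 1 := by
      intro g hm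
      refine Units.ext (hback g _ 1 hm ?_)
      have : (![1,1,1,1] : Fin 4 → K) = 1 := by
        ext i
        fin_cases i <;> rfl
      rw [this, one_mul, Matrix.diagonal_one', mul_one]
    by_contra hcon
    push Not at hcon
    obtain ⟨⟨g, hg, hgx, hgy, hg1⟩, h, hh, hhx, hhy, hh1⟩ := hcon
    obtain ⟨σ, c, hc, hm, h0, hc0⟩ := hmono _ (hnorm g hg) (hfix g _ _ eigenMatrix_mulVec_first hgy)
    obtain ⟨τ, d, hd, hn, k0, hd0⟩ := hmono _ (hnorm h hh) (hfix h _ _ eigenMatrix_mulVec_first hhy)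
    rcases perm_cases_of_fix_third hc hm h0 hc0 (hsq g hg σ c hc hm)
      (hfix g _ _ (eigenMatrix_mulVec_third h3K) hgx) with
      rfl | ⟨rfl, rfl | rfl⟩
    · rcases perm_cases_of_fix_fourth hd hn k0 hd0 (hsq h hh τ d hd hn)
        (hfix h _ _ (eigenMatrix_mulVec_fourth h3K) hhx) with
        rfl | ⟨rfl, rfl | rfl⟩
      · have hmn := hm.mul hn
        rw [← Units.val_mul] at hmn
        have hconj : E⁻¹ * g * E * (E⁻¹ * h * E) = MulAut.conj E⁻¹ (g * h) := by
          simp [mul_assoc]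
        have := hmn.perm_eq_one_of_pow_three (fun i => mul_ne_zero (hc _) (hd _)) (by
          rw [hconj, MulEquiv.orderOf_eq]
          exact hord _ (mul_mem hg hh))
        revert this
        decide
      · exact hh1 (hone h hn)
      · refine hno h hh ![1,-1,1,-1] (by simp [Fin.forall_fin_succ]) ?_
        rw [hback h _ _ hn mul_eigenMatrix_eq_third]
        exact isMonomialWith_neg_swap
    · exact hg1 (hone g hm)
    · refine hno g hg 1 (by simp) ?_
      rw [hback g _ _ hm mul_eigenMatrix_eq_fourth]
      exact isMonomialWith_swap
end

section
/- Let q = p^a with p an odd prime and q ∉ {3, 5, 9}. Let V = F_q^4 with basis u_1, u_2, u_3, u_4, A ≤ GL(4, q) the group of scalar matrices, d_1 = diag(1, 1, -1, -1), d_2 = diag(1, -1, 1, -1), s_1 the permutation matrix swapping u_1↔u_2 and u_3↔u_4, s_2 the permutation matrix swapping u_1↔u_3 and u_2↔u_4, and F = A⟨d_1, d_2, s_1, s_2⟩. Let G be a finite group with F ⊴ G ≤ GL(4, q) and gcd(|G|, p) = 1, and let α be a generator of the multiplicative group F_q^*. Then for x = u_2 + α u_3 + α^{-1} u_4 and y =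 u_1, we have C_G(x) ∩ C_G(y) = 1. -/
open Matrix

/-- A matrix acts as a *signed translation* if it permutes the coordinates by a translation of the
elementary abelian group `(Fin 4, ^^^)`, up to signs and a common nonzero scalar. -/
def IsSignedTranslation {K : Type*} [Field K] (M : Matrix (Fin 4) (Fin 4) K) : Prop :=
  ∃ (t : Fin 4) (c : Fin 4 → K) (k : K), k ≠ 0 ∧ (∀ i, c i = k ∨ c i = -k) ∧
    ∀ v i, (M *ᵥ v) i = c i * v (i ^^^ t)

theorem Fin.xor_xor_cancel_four (i t : Fin 4) : i ^^^ t ^^^ t = i := by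
  revert i t; decide

theorem Fin.xor_assoc_four (i s t : Fin 4) : i ^^^ s ^^^ t = i ^^^ (s ^^^ t) := by
  revert i s t; decide

theorem Fin.xor_zero_four (i : Fin 4) : i ^^^ 0 = i := by
  revert i; decide

theorem Fin.zero_xor_four (i : Fin 4) : 0 ^^^ i = i := by
  revert i; decide

theorem Fin.xor_eq_zero_iff_four (i j : Fin 4) : i ^^^ j = 0 ↔ i = j := by
  revert i j; decide

namespace IsSignedTranslation

variable {K : Type*} [Field K]

theorem mul {M N : Matrix (Fin 4) (Fin 4) K} (hM : IsSignedTranslation M)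
    (hN : IsSignedTranslation N) : IsSignedTranslation (M * N) := by
  obtain ⟨s, c, k, hk, hc, hM⟩ := hM
  obtain ⟨t, d, l, hl, hd, hN⟩ := hN
  refine ⟨s ^^^ t, fun i => c i * d (i ^^^ s), k * l, mul_ne_zero hk hl, fun i => ?_,
    fun v i => ?_⟩
  · rcases hc i with h | h <;> rcases hd (i ^^^ s) with h' | h' <;> simp [h, h']
  · rw [← Matrix.mulVec_mulVec, hM, hN, Fin.xor_assoc_four, mul_assoc]

theorem inv {g : GL (Fin 4) K} (hg : IsSignedTranslation (g : Matrix (Fin 4) (Fin 4) K)) :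
    IsSignedTranslation ((g⁻¹ : GL (Fin 4) K) : Matrix (Fin 4) (Fin 4) K) := by
  obtain ⟨t, c, k, hk, hc, hg⟩ := hg
  refine ⟨t, fun i => (c (i ^^^ t))⁻¹, k⁻¹, inv_ne_zero hk, fun i => ?_, fun v i => ?_⟩
  · rcases hc (i ^^^ t) with h | h <;> simp [h, inv_neg]
  · have hne : c (i ^^^ t) ≠ 0 := by
      rcases hc (i ^^^ t) with h | h <;> simpa [h] using hk
    have h := hg (((g⁻¹ : GL (Fin 4) K) : Matrix (Fin 4) (Fin 4) K) *ᵥ v) (i ^^^ t)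
    rw [Matrix.mulVec_mulVec, ← Units.val_mul, mul_inv_cancel, Units.val_one, Matrix.one_mulVec,
      Fin.xor_xor_cancel_four] at h
    rw [h, inv_mul_cancel_left₀ hne]

theorem scalar {k : K} (hk : k ≠ 0) : IsSignedTranslation (Matrix.scalar (Fin 4) k) :=
  ⟨0, fun _ => k, k, hk, fun _ => Or.inl rfl, fun v i => by
    rw [Fin.xor_zero_four]
    simp [Matrix.mulVec_diagonal]⟩

/-- A signed translation fixing the first basis vector is diagonal. -/
theorem exists_eq_mul_of_fixes {M : Matrix (Fin 4) (Fin 4) K} (hM : IsSignedTranslation M)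
    (h0 : M *ᵥ ![1, 0, 0, 0] = ![1, 0, 0, 0]) :
    ∃ c : Fin 4 → K, ∀ v i, (M *ᵥ v) i = c i * v i := by
  obtain ⟨t, c, k, -, -, hM⟩ := hM
  have h := hM ![1, 0, 0, 0] 0
  rw [h0] at h
  have ht : t = 0 := by
    by_contra ht
    fin_cases t <;> simp at h ht
  subst ht
  exact ⟨c, fun v i => by rw [hM, Fin.xor_zero_four]⟩

/-- The subgroup of `GL(4, K)` of all signed translations. -/
def subgroup (K : Type*) [Field K] : Subgroup (GL (Fin 4) K) where
  carrier := {g | IsSignedTranslation (g : Matrix (Fin 4) (Fin 4) K)}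
  mul_mem' ha hb := ha.mul hb
  one_mem' := by simpa using scalar (one_ne_zero (α := K))
  inv_mem' := inv

end IsSignedTranslation

/-- If `f` is a signed translation with `g * s = f * g`, where `g` fixes the first basis vector
and `s` swaps it with the `t`-th one, then the nonzero entries of the `t`-th column of `g` are
fourth roots of unity. -/
theorem pow_four_eq_one_of_conj_swap {K : Type*} [Field K] {g s f : Matrix (Fin 4) (Fin 4) K}
    (hf : IsSignedTranslation f) (hgs : g * s = f * g)
    (hg : g *ᵥ ![1, 0, 0, 0] = ![1, 0, 0, 0]) {t : Fin 4}
    (hs : s *ᵥ ![1, 0, 0, 0] = Pi.single t 1) (hs' : s *ᵥ Pi.single t 1 = ![1, 0, 0, 0])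
    (i : Fin 4) (hi : g i t ≠ 0) : g i t ^ 4 = 1 := by
  obtain ⟨r, c, k, hk, hc, hf⟩ := hf
  have hcol : ∀ i, g i t = c i * (![1, 0, 0, 0] : Fin 4 → K) (i ^^^ r) := fun i => by
    have h := congrArg (fun M => (M *ᵥ ![1, 0, 0, 0]) i) hgs
    simpa only [← Matrix.mulVec_mulVec, hs, hg, hf, Matrix.mulVec_single_one, Matrix.col_apply]
      using h
  have hir : i = r := by
    rw [hcol] at hi
    rw [← Fin.xor_eq_zero_iff_four]
    generalize i ^^^ r = j at hi ⊢
    fin_cases j <;> simp at hi ⊢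
  subst hir
  have hgi : g i t = c i := by
    rw [hcol, (Fin.xor_eq_zero_iff_four i i).mpr rfl]; simp
  have h1 : 1 = c 0 * c i := by
    have h := congrArg (fun M => (M *ᵥ Pi.single t 1) 0) hgs
    simp only [← Matrix.mulVec_mulVec, hs', hg, hf, Fin.zero_xor_four] at h
    simpa only [Matrix.mulVec_single_one, Matrix.col_apply, hgi, Matrix.cons_val_zero] using h
  have hsq : ∀ j, c j ^ 2 = k ^ 2 := fun j => by rcases hc j with h | h <;> simp [h]
  calc g i t ^ 4 = c 0 ^ 2 * c i ^ 2 := by rw [hgi, hsq 0, ← hsq i]; ring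
    _ = 1 := by rw [← mul_pow, ← h1, one_pow]

/-- A generator of the multiplicative group of a finite field of odd order `q ∉ {3, 5, 9}` does
not have order dividing `8`. -/
theorem generator_pow_eight_ne_one {K : Type*} [Field K] [Fintype K]
    (hodd : Odd (Fintype.card K)) (hq3 : Fintype.card K ≠ 3) (hq5 : Fintype.card K ≠ 5)
    (hq9 : Fintype.card K ≠ 9) {α : Kˣ} (hα : ∀ β : Kˣ, β ∈ Subgroup.zpowers α) :
    α ^ 8 ≠ 1 := by
  intro h
  have hdvd := orderOf_dvd_of_pow_eq_one h
  rw [orderOf_eq_card_of_forall_mem_zpowers hα, Nat.card_units, Nat.card_eq_fintype_card] at hdvd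
  have hle := Nat.le_of_dvd (by norm_num) hdvd
  have hpos := Fintype.one_lt_card (α := K)
  obtain ⟨m, hm⟩ := hodd
  have : Fintype.card K ≤ 9 := by omega
  interval_cases Fintype.card K <;> omega

/-- **Halasi–Podoski, Theorem 3.10 (the case `GL(4, q)`, `q ∉ {3, 5, 9}`).**
Let `q = p^a` with `p` an odd prime and `q ∉ {3, 5, 9}`.  Let `V = 𝔽_q^4` with standard basis
`u₁,…,u₄`, `A ≤ GL(4,q)` the scalar matrices, `d₁ = diag(1,1,-1,-1)`, `d₂ = diag(1,-1,1,-1)`,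
`s₁` the permutation matrix swapping `u₁↔u₂, u₃↔u₄`, `s₂` the one swapping `u₁↔u₃, u₂↔u₄`,
and `F = A⟨d₁,d₂,s₁,s₂⟩`.  Let `F ⊴ G ≤ GL(4,q)` with `gcd(|G|, p) = 1` and let `α` generate
`𝔽_q^*`.  Then for `x = u₂ + αu₃ + α⁻¹u₄` and `y = u₁` we have `C_G(x) ∩ C_G(y) = 1`. -/
theorem base_for_GL4_generic_field
    (p a : ℕ) (hp : p.Prime) (hp2 : p ≠ 2)
    (K : Type*) [Field K] [Fintype K] (hK : Fintype.card K = p ^ a)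
    (hq3 : Fintype.card K ≠ 3) (hq5 : Fintype.card K ≠ 5) (hq9 : Fintype.card K ≠ 9)
    (A : Subgroup (GL (Fin 4) K))
    (hA : A = (Units.map (Matrix.scalar (Fin 4) :
      K →+* Matrix (Fin 4) (Fin 4) K).toMonoidHom).range)
    (d₁ d₂ s₁ s₂ : GL (Fin 4) K)
    (hd₁ : (d₁ : Matrix (Fin 4) (Fin 4) K) = Matrix.diagonal ![1, 1, -1, -1])
    (hd₂ : (d₂ : Matrix (Fin 4) (Fin 4) K) = Matrix.diagonal ![1, -1, 1, -1])
    (hs₁ : (s₁ : Matrix (Fin 4) (Fin 4) K) = !![0,1,0,0; 1,0,0,0; 0,0,0,1; 0,0,1,0])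
    (hs₂ : (s₂ : Matrix (Fin 4) (Fin 4) K) = !![0,0,1,0; 0,0,0,1; 1,0,0,0; 0,1,0,0])
    (Fsub G : Subgroup (GL (Fin 4) K))
    (hF : Fsub = A ⊔ Subgroup.closure {d₁, d₂, s₁, s₂})
    (hFG : Fsub ≤ G)
    (hFnormal : ∀ g ∈ G, ∀ f ∈ Fsub, g * f * g⁻¹ ∈ Fsub)
    (hGcop : Nat.Coprime (Nat.card G) p)
    (α : Kˣ) (hα : ∀ β : Kˣ, β ∈ Subgroup.zpowers α) :
    ∀ g ∈ G,
      (g : Matrix (Fin 4) (Fin 4) K) *ᵥ ![0, 1, (α : K), ((α⁻¹ : Kˣ) : K)]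
        = ![0, 1, (α : K), ((α⁻¹ : Kˣ) : K)] →
      (g : Matrix (Fin 4) (Fin 4) K) *ᵥ ![1, 0, 0, 0] = ![1, 0, 0, 0] →
      g = 1 := by
  have hFle : Fsub ≤ IsSignedTranslation.subgroup K := by
    rw [hF, sup_le_iff, hA, Subgroup.closure_le]
    constructor
    · rintro _ ⟨k, rfl⟩
      exact IsSignedTranslation.scalar k.ne_zero
    · rintro _ (rfl | rfl | rfl | rfl)
      · refine ⟨0, ![1, 1, -1, -1], 1, one_ne_zero, fun i => ?_, fun v i => ?_⟩
        · fin_cases i <;> simp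
        · rw [hd₁, Matrix.mulVec_diagonal, Fin.xor_zero_four]
      · refine ⟨0, ![1, -1, 1, -1], 1, one_ne_zero, fun i => ?_, fun v i => ?_⟩
        · fin_cases i <;> simp
        · rw [hd₂, Matrix.mulVec_diagonal, Fin.xor_zero_four]
      · refine ⟨1, fun _ => 1, 1, one_ne_zero, fun i => Or.inl rfl, fun v i => ?_⟩
        rw [hs₁]
        fin_cases i <;> simp [Matrix.mulVec, dotProduct, Fin.sum_univ_four]
      · refine ⟨2, fun _ => 1, 1, one_ne_zero, fun i => Or.inl rfl, fun v i => ?_⟩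
        rw [hs₂]
        fin_cases i <;> simp [Matrix.mulVec, dotProduct, Fin.sum_univ_four]
  have hmem : ∀ f ∈ ({d₁, d₂, s₁, s₂} : Set (GL (Fin 4) K)), f ∈ Fsub := fun f hf =>
    hF ▸ Subgroup.mem_sup_right (Subgroup.subset_closure hf)
  intro g hgG hx hy
  have hconj : ∀ s ∈ Fsub, ∃ f : Matrix (Fin 4) (Fin 4) K, IsSignedTranslation f ∧
      (g : Matrix (Fin 4) (Fin 4) K) * (s : Matrix (Fin 4) (Fin 4) K) =
        f * (g : Matrix (Fin 4) (Fin 4) K) := fun s hs =>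
    ⟨_, hFle (hFnormal g hgG s hs), by simp only [← Units.val_mul, inv_mul_cancel_right]⟩
  have hdiag : ∀ d ∈ Fsub, ∀ e : Fin 4 → K,
      (d : Matrix (Fin 4) (Fin 4) K) = Matrix.diagonal e → e 0 = 1 →
      ∃ c : Fin 4 → K, ∀ i j, (g : Matrix (Fin 4) (Fin 4) K) i j ≠ 0 → e j = c i := by
    intro d hd e hde he
    obtain ⟨f, hf, hgf⟩ := hconj d hd
    have hfy : f *ᵥ ![1, 0, 0, 0] = ![1, 0, 0, 0] := by
      have h := congrArg (fun M => M *ᵥ ![1, 0, 0, 0]) hgf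
      have hdy : (d : Matrix (Fin 4) (Fin 4) K) *ᵥ ![1, 0, 0, 0] = ![1, 0, 0, 0] := by
        ext i
        rw [hde, Matrix.mulVec_diagonal]
        fin_cases i <;> simp [he]
      simp only [← Matrix.mulVec_mulVec, hdy, hy] at h
      exact h.symm
    obtain ⟨c, hc⟩ := hf.exists_eq_mul_of_fixes hfy
    refine ⟨c, fun i j hij => ?_⟩
    have h := congrArg (fun M => (M *ᵥ Pi.single j 1) i) hgf
    simp only [← Matrix.mulVec_mulVec, hc] at h
    rw [Matrix.mulVec_mulVec, hde] at h
    simp only [Matrix.mulVec_single_one, Matrix.col_apply, Matrix.mul_diagonal] at h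
    rw [mul_comm] at h
    exact mul_right_cancel₀ hij h
  have hodd : Odd (Fintype.card K) := hK ▸ (hp.odd_of_ne_two hp2).pow
  have htwo : (1 : K) ≠ -1 := by
    intro h
    refine (Ring.neg_one_ne_one_of_char_ne_two (R := K) fun hchar => ?_) h.symm
    exact (Nat.not_even_iff_odd.mpr hodd)
      (Nat.even_iff.mpr (FiniteField.even_card_of_char_two hchar))
  have hunique : ∀ i j j', (g : Matrix (Fin 4) (Fin 4) K) i j ≠ 0 →
      (g : Matrix (Fin 4) (Fin 4) K) i j' ≠ 0 → j = j' := by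
    obtain ⟨c, hc⟩ := hdiag d₁ (hmem _ (by simp)) _ hd₁ rfl
    obtain ⟨c', hc'⟩ := hdiag d₂ (hmem _ (by simp)) _ hd₂ rfl
    intro i j j' hj hj'
    have h := (hc i j hj).trans (hc i j' hj').symm
    have h' := (hc' i j hj).trans (hc' i j' hj').symm
    clear hj hj'
    fin_cases j <;> fin_cases j' <;> simp [htwo, htwo.symm] at h h' ⊢
  have hpow : ∀ i j, (g : Matrix (Fin 4) (Fin 4) K) i j ≠ 0 →
      (g : Matrix (Fin 4) (Fin 4) K) i j ^ 4 = 1 := by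
    have hs₁F := hmem s₁ (by simp)
    have hs₂F := hmem s₂ (by simp)
    have hswap : ∀ s ∈ Fsub, ∀ t : Fin 4,
        (s : Matrix (Fin 4) (Fin 4) K) *ᵥ ![1, 0, 0, 0] = Pi.single t 1 →
        (s : Matrix (Fin 4) (Fin 4) K) *ᵥ Pi.single t 1 = ![1, 0, 0, 0] →
        ∀ i, (g : Matrix (Fin 4) (Fin 4) K) i t ≠ 0 →
          (g : Matrix (Fin 4) (Fin 4) K) i t ^ 4 = 1 := by
      intro s hs t h h'
      obtain ⟨f, hf, hgf⟩ := hconj s hs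
      exact pow_four_eq_one_of_conj_swap hf hgf hy h h'
    intro i j
    revert i
    fin_cases j
    · refine hswap 1 (one_mem _) 0 ?_ ?_ <;> ext i <;> fin_cases i <;> simp
    · refine hswap s₁ hs₁F 1 ?_ ?_ <;> rw [hs₁] <;> ext i <;> fin_cases i <;>
        simp [Matrix.mulVec, dotProduct, Fin.sum_univ_four]
    · refine hswap s₂ hs₂F 2 ?_ ?_ <;> rw [hs₂] <;> ext i <;> fin_cases i <;>
        simp [Matrix.mulVec, dotProduct, Fin.sum_univ_four]
    · refine hswap (s₁ * s₂) (mul_mem hs₁F hs₂F) 3 ?_ ?_ <;>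
        rw [Units.val_mul, hs₁, hs₂, ← Matrix.mulVec_mulVec] <;> ext i <;> fin_cases i <;>
        simp [Matrix.mulVec, dotProduct, Fin.sum_univ_four]
  have hα8 : (α : K) ^ 8 ≠ 1 := fun h =>
    generator_pow_eight_ne_one hodd hq3 hq5 hq9 hα (Units.ext (by simpa using h))
  have hα4 : (α : K) ^ 4 ≠ 1 := fun h => hα8 (by rw [show 8 = 4 * 2 from rfl, pow_mul, h, one_pow])
  have hα0 : (α : K) ≠ 0 := α.ne_zero
  have hcol : ∀ i, (g : Matrix (Fin 4) (Fin 4) K) i 0 = (![1, 0, 0, 0] : Fin 4 → K) i :=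
    fun i => by
      have h := congrFun hy i
      simpa [Matrix.mulVec, dotProduct, Fin.sum_univ_four] using h
  set x : Fin 4 → K := ![0, 1, (α : K), ((α⁻¹ : Kˣ) : K)] with hxdef
  have hrow : ∀ i j, (g : Matrix (Fin 4) (Fin 4) K) i j ≠ 0 →
      (g : Matrix (Fin 4) (Fin 4) K) i j * x j = x i := by
    intro i j hij
    refine Eq.trans ?_ (congrFun hx i)
    rw [Matrix.mulVec, dotProduct, Finset.sum_eq_single_of_mem j (Finset.mem_univ j)]
    intro j' _ hne
    by_contra h
    exact hne (hunique i j' j (left_ne_zero_of_mul h) hij)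
  have hoff : ∀ i j, (g : Matrix (Fin 4) (Fin 4) K) i j ≠ 0 → i = j := by
    intro i j hij
    have h4 : x j ^ 4 = x i ^ 4 := by rw [← hrow i j hij, mul_pow, hpow i j hij, one_mul]
    by_contra hne
    have hi0 : j = 0 → i = 0 := by
      rintro rfl
      rw [hcol] at hij
      fin_cases i <;> simp at hij ⊢
    have hinv : (α : K)⁻¹ ^ 4 * (α : K) ^ 4 = 1 := by
      rw [← mul_pow, inv_mul_cancel₀ hα0, one_pow]
    have hne48 : (α : K)⁻¹ ^ 4 ≠ (α : K) ^ 4 := fun h => hα8 (by rw [← hinv, h]; ring)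
    have hne4 : (α : K)⁻¹ ^ 4 ≠ 1 := fun h => hα4 (by rw [← hinv, h, one_mul])
    clear hij
    fin_cases i <;> fin_cases j <;>
      simp [hxdef, -inv_pow, hα0, hα4, hα4.symm, hne4, hne4.symm, hne48, hne48.symm]
        at h4 hne hi0
  have hdiag_ne : ∀ i, (g : Matrix (Fin 4) (Fin 4) K) i i ≠ 0 := by
    intro i hi
    have hzero : ∀ j, (g : Matrix (Fin 4) (Fin 4) K) i j = 0 := fun j => by
      by_contra h
      exact h (by rw [← hoff i j h, hi])
    have hdet := Matrix.det_eq_zero_of_row_eq_zero i hzero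
    exact ((Matrix.isUnit_iff_isUnit_det _).mp g.isUnit).ne_zero hdet
  ext i j
  rw [Units.val_one]
  by_cases hij : i = j
  · subst hij
    rw [Matrix.one_apply_eq]
    by_cases hi : i = 0
    · subst hi
      exact hcol 0
    · have hxi : x i ≠ 0 := by
        fin_cases i <;> simp [hxdef] at hi ⊢
      exact mul_right_cancel₀ hxi (by rw [hrow i i (hdiag_ne i), one_mul])
  · rw [Matrix.one_apply_ne hij]
    by_contra h
    exact hij (hoff i j h)
end

section
/- Let q = p^a with p an odd prime, and assume the multiplicative group F_q^* contains no element of order 4 (equivalently, q ≡ 3 mod 4). Let V be a finite-dimensional F_q-vector space, let Q ≤ GL(V) be a quaternion group of order 8 whose unique involution is -I, and let D ≤ GL(V) be a finite abelian subgroup of order coprime to p that centralizes Q and whose exponent is not divisible by 4. Then for every element q_0 ∈ Q with q_0 ∉ {I, -I} and every d ∈ D, the linear map g = q_0 d has no eigenvalue in F_q; consequently, every element of the set QD = {q_0 d : q_0 ∈ Q, d ∈ D} that has an eigenvalue in F_q lies in {±I}·D. -/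
theorem QuaternionGroup.two_pow_four (x : QuaternionGroup 2) : x ^ 4 = 1 := by
  revert x
  decide

theorem exists_odd_dvd_two_mul {n : ℕ} (hn : ¬ 4 ∣ n) : ∃ m, Odd m ∧ n ∣ 2 * m := by
  rcases Nat.even_or_odd n with ⟨k, hk⟩ | h
  · exact ⟨k, by rw [Nat.odd_iff]; omega, by rw [hk, two_mul]⟩
  · exact ⟨n, h, Dvd.intro_left 2 rfl⟩

theorem sq_ne_neg_one_of_orderOf_units_ne_four {K : Type*} [Field K] (h2 : (-1 : K) ≠ 1)
    (hno4 : ∀ c : Kˣ, orderOf c ≠ 4) (c : K) : c ^ 2 ≠ -1 := by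
  intro hc
  have hc0 : c ≠ 0 := by
    rintro rfl
    simp at hc
  refine hno4 (Units.mk0 c hc0) (orderOf_eq_prime_pow (p := 2) (n := 1) ?_ ?_)
  · rw [Units.ext_iff]
    simpa [hc] using h2
  · rw [Units.ext_iff]
    change c ^ (2 * 2) = 1
    rw [pow_mul, hc, neg_one_sq]

theorem FiniteField.neg_one_ne_one_of_odd_card {K : Type*} [Field K] [Fintype K]
    (h : Odd (Fintype.card K)) : (-1 : K) ≠ 1 := by
  refine Ring.neg_one_ne_one_of_char_ne_two fun hchar => ?_
  have := FiniteField.even_card_of_char_two hchar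
  rw [Nat.odd_iff] at h
  omega

theorem Module.End.pow_apply_of_apply_eq_smul {K V : Type*} [CommRing K] [AddCommGroup V]
    [Module K V] {f : Module.End K V} {c : K} {v : V} (h : f v = c • v) (n : ℕ) :
    (f ^ n) v = c ^ n • v := by
  induction n with
  | zero => simp
  | succ n ih => rw [pow_succ, Module.End.mul_apply, h, map_smul, ih, smul_smul, ← pow_succ']

/-- **Halasi–Podoski, Theorem 3.12, part 6.**
Let `q = p^a`, `p` an odd prime, and assume `𝔽_q^*` has no element of order 4 (equivalently
`q ≡ 3 (mod 4)`).  Let `V` be a finite-dimensional `𝔽_q`-vector space, `Q ≤ GL(V)` a quaternion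
group of order 8 whose unique involution is `-I`, and `D ≤ GL(V)` a finite abelian subgroup of
order coprime to `p` that centralizes `Q` and whose exponent is not divisible by 4.  Then every
`q₀ ∈ Q \ {±I}` and `d ∈ D` give `g = q₀d` without eigenvalues in `𝔽_q`; consequently every
element of `QD` having an eigenvalue in `𝔽_q` lies in `{±I}·D`. -/
theorem quaternion_times_diagonal_has_no_eigenvalue
    (p a : ℕ) (hp : p.Prime) (hp2 : p ≠ 2)
    (K : Type*) [Field K] [Fintype K] (hK : Fintype.card K = p ^ a)
    (hno4 : ∀ c : Kˣ, orderOf c ≠ 4)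
    (V : Type*) [AddCommGroup V] [Module K V] [FiniteDimensional K V]
    (Q : Subgroup (LinearMap.GeneralLinearGroup K V))
    (hQ8 : Nonempty (Q ≃* QuaternionGroup 2))
    (hQneg : (-1 : (V →ₗ[K] V)ˣ) ∈ Q)
    (hQinv : ∀ g ∈ Q, g * g = 1 → g = 1 ∨ g = (-1 : (V →ₗ[K] V)ˣ))
    (D : Subgroup (LinearMap.GeneralLinearGroup K V)) [Finite D]
    (hDab : ∀ x ∈ D, ∀ y ∈ D, Commute x y)
    (hDcop : Nat.Coprime (Nat.card D) p)
    (hDQ : ∀ d ∈ D, ∀ q₀ ∈ Q, Commute d q₀)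
    (hDexp : ¬ (4 ∣ Monoid.exponent D)) :
    (∀ q₀ ∈ Q, q₀ ≠ 1 → q₀ ≠ (-1 : (V →ₗ[K] V)ˣ) → ∀ d ∈ D,
      ∀ (lam : K) (v : V), v ≠ 0 → ((q₀ * d : (V →ₗ[K] V)ˣ) : V →ₗ[K] V) v ≠ lam • v) ∧
    (∀ q₀ ∈ Q, ∀ d ∈ D,
      (∃ (lam : K) (v : V), v ≠ 0 ∧ ((q₀ * d : (V →ₗ[K] V)ˣ) : V →ₗ[K] V) v = lam • v) →
      q₀ = 1 ∨ q₀ = (-1 : (V →ₗ[K] V)ˣ)) := by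
  have hchar : (-1 : K) ≠ 1 :=
    FiniteField.neg_one_ne_one_of_odd_card (hK ▸ (hp.odd_of_ne_two hp2).pow)
  have main : ∀ q₀ ∈ Q, q₀ ≠ 1 → q₀ ≠ (-1 : (V →ₗ[K] V)ˣ) → ∀ d ∈ D,
      ∀ (lam : K) (v : V), v ≠ 0 →
        ((q₀ * d : (V →ₗ[K] V)ˣ) : V →ₗ[K] V) v ≠ lam • v := by
    intro q₀ hq₀ hq1 hqneg d hd lam v hv heig
    obtain ⟨e⟩ := hQ8
    have hq4 : q₀ ^ 4 = 1 := by
      have h : (⟨q₀, hq₀⟩ : Q) ^ 4 = 1 :=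
        e.injective (by rw [map_pow, map_one, QuaternionGroup.two_pow_four])
      exact congrArg Subtype.val h
    have hq2 : q₀ ^ 2 = (-1 : (V →ₗ[K] V)ˣ) := by
      refine (hQinv (q₀ ^ 2) (Q.pow_mem hq₀ 2) (by rw [← pow_add, hq4])).resolve_left fun h => ?_
      exact (hQinv q₀ hq₀ (by rw [← sq, h])).elim hq1 hqneg
    obtain ⟨m, hm, hdvd⟩ := exists_odd_dvd_two_mul hDexp
    have hdm : d ^ (2 * m) = 1 :=
      congrArg Subtype.val (Monoid.exponent_dvd_iff_forall_pow_eq_one.mp hdvd (⟨d, hd⟩ : D))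
    have hg : (q₀ * d) ^ (2 * m) = (-1 : (V →ₗ[K] V)ˣ) := by
      rw [(hDQ d hd q₀ hq₀).symm.mul_pow, hdm, mul_one, pow_mul, hq2, hm.neg_one_pow]
    have hpow := Module.End.pow_apply_of_apply_eq_smul heig (2 * m)
    rw [← Units.val_pow_eq_pow_val, hg] at hpow
    have hlam : lam ^ (2 * m) = -1 :=
      smul_left_injective K hv (by simpa using hpow.symm)
    exact sq_ne_neg_one_of_orderOf_units_ne_four hchar hno4 (lam ^ m)
      (by rw [← pow_mul, mul_comm, hlam])
  refine ⟨main, fun q₀ hq₀ d hd ⟨lam, v, hv, heig⟩ => ?_⟩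
  by_contra! h
  exact main q₀ hq₀ h.1 h.2 d hd lam v hv heig
end
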